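/- Let φ : ℂ → ℝ be a nonnegative subharmonic C²-function such that the measure dμ = Δφ dλ (λ Lebesgue measure on ℂ) is a nontrivial doubling measure. Then the weighted Bergman space A²(ℂ, e^{−φ}) of entire functions f with ∫_ℂ |f|² e^{−φ} dλ < ∞ is an infinite-dimensional complex vector space. -/

import Mathlib

open MeasureTheory

/-- The partial derivative `∂φ/∂x` of `φ : ℂ → ℝ` (identifying `ℂ` with `ℝ²`, `z = x + iy`). -/
noncomputable def pdxR (φ : ℂ → ℝ) (z : ℂ) : ℝ := fderiv ℝ φ z 1

/-- The partial derivative `∂φ/∂y` of `φ : ℂ → ℝ`. -/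
noncomputable def pdyR (φ : ℂ → ℝ) (z : ℂ) : ℝ := fderiv ℝ φ z Complex.I

/-- The Laplacian `Δφ = ∂²φ/∂x² + ∂²φ/∂y²` of `φ : ℂ → ℝ`. -/
noncomputable def lap (φ : ℂ → ℝ) (z : ℂ) : ℝ :=
  pdxR (fun w => pdxR φ w) z + pdyR (fun w => pdyR φ w) z

open Complex ComplexConjugate

/-- The Wirtinger derivative `∂f/∂z`. -/
noncomputable def dz (f : ℂ → ℂ) (z : ℂ) : ℂ := (fderiv ℝ f z 1 - I * fderiv ℝ f z I) / 2

/-- The Wirtinger derivative `∂f/∂z̄`. -/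
noncomputable def dzbar (f : ℂ → ℂ) (z : ℂ) : ℂ := (fderiv ℝ f z 1 + I * fderiv ℝ f z I) / 2

lemma ContDiff.dz {n : ℕ∞} {f : ℂ → ℂ} (hf : ContDiff ℝ (n + 1) f) : ContDiff ℝ n (dz f) := by
  have h := hf.fderiv_right (m := n) le_rfl
  unfold _root_.dz
  fun_prop

lemma ContDiff.dzbar {n : ℕ∞} {f : ℂ → ℂ} (hf : ContDiff ℝ (n + 1) f) :
    ContDiff ℝ n (dzbar f) := by
  have h := hf.fderiv_right (m := n) le_rfl
  unfold _root_.dzbar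
  fun_prop

lemma contDiff_one_dz {f : ℂ → ℂ} (hf : ContDiff ℝ 2 f) : ContDiff ℝ 1 (dz f) :=
  ContDiff.dz (n := 1) (by simpa using hf.of_le (by norm_num))

lemma contDiff_one_dzbar {f : ℂ → ℂ} (hf : ContDiff ℝ 2 f) : ContDiff ℝ 1 (dzbar f) :=
  ContDiff.dzbar (n := 1) (by simpa using hf.of_le (by norm_num))

lemma continuous_dz {f : ℂ → ℂ} (hf : ContDiff ℝ 1 f) : Continuous (dz f) :=
  (ContDiff.dz (n := 0) (by simpa using hf)).continuous

lemma continuous_dzbar {f : ℂ → ℂ} (hf : ContDiff ℝ 1 f) : Continuous (dzbar f) :=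
  (ContDiff.dzbar (n := 0) (by simpa using hf)).continuous

lemma HasCompactSupport.dz {f : ℂ → ℂ} (hf : HasCompactSupport f) : HasCompactSupport (dz f) :=
  (hf.fderiv ℝ).mono fun z hz => by
    contrapose! hz
    simp only [Function.mem_support, not_not] at hz ⊢
    simp [_root_.dz, hz]

lemma HasCompactSupport.dzbar {f : ℂ → ℂ} (hf : HasCompactSupport f) :
    HasCompactSupport (dzbar f) :=
  (hf.fderiv ℝ).mono fun z hz => by
    contrapose! hz
    simp only [Function.mem_support, not_not] at hz ⊢
    simp [_root_.dzbar, hz]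

lemma dz_mul {f g : ℂ → ℂ} {z : ℂ} (hf : DifferentiableAt ℝ f z) (hg : DifferentiableAt ℝ g z) :
    dz (fun w => f w * g w) z = dz f z * g z + f z * dz g z := by
  simp only [dz, fderiv_fun_mul hf hg, _root_.add_apply,
    _root_.smul_apply, smul_eq_mul]
  ring

lemma dzbar_mul {f g : ℂ → ℂ} {z : ℂ} (hf : DifferentiableAt ℝ f z)
    (hg : DifferentiableAt ℝ g z) :
    dzbar (fun w => f w * g w) z = dzbar f z * g z + f z * dzbar g z := by
  simp only [dzbar, fderiv_fun_mul hf hg, _root_.add_apply,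
    _root_.smul_apply, smul_eq_mul]
  ring

lemma dzbar_sub {f g : ℂ → ℂ} {z : ℂ} (hf : DifferentiableAt ℝ f z)
    (hg : DifferentiableAt ℝ g z) :
    dzbar (fun w => f w - g w) z = dzbar f z - dzbar g z := by
  simp only [dzbar, fderiv_fun_sub hf hg, _root_.sub_apply]
  ring

lemma fderiv_conj {f : ℂ → ℂ} {z : ℂ} (v : ℂ) :
    fderiv ℝ (fun w => conj (f w)) z v = conj (fderiv ℝ f z v) := by
  have h := conjCLE.comp_fderiv (f := f) (x := z)
  have h2 : (conjCLE ∘ f) = fun w => conj (f w) := by ext w; simp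
  rw [h2] at h
  rw [h]; simp

lemma dz_conj (f : ℂ → ℂ) (z : ℂ) : dz (fun w => conj (f w)) z = conj (dzbar f z) := by
  simp [dz, dzbar, fderiv_conj, sub_eq_add_neg, conj_ofNat]

lemma dzbar_conj (f : ℂ → ℂ) (z : ℂ) : dzbar (fun w => conj (f w)) z = conj (dz f z) := by
  simp [dz, dzbar, fderiv_conj, sub_eq_add_neg, conj_ofNat]

lemma fderiv_fderiv_apply {f : ℂ → ℂ} (hf : ContDiff ℝ 2 f) (z v w : ℂ) :
    fderiv ℝ (fun u => fderiv ℝ f u v) z w = fderiv ℝ (fderiv ℝ f) z w v := by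
  have h : DifferentiableAt ℝ (fderiv ℝ f) z :=
    ((hf.fderiv_right (m := 1) (by norm_num)).differentiable (by norm_num)) z
  rw [fderiv_clm_apply h (by fun_prop)]
  simp

lemma fderiv_fderiv_comm {f : ℂ → ℂ} (hf : ContDiff ℝ 2 f) (z v w : ℂ) :
    fderiv ℝ (fderiv ℝ f) z v w = fderiv ℝ (fderiv ℝ f) z w v :=
  (hf.contDiffAt.isSymmSndFDerivAt (by simp)).eq v w

lemma fderiv_dz {f : ℂ → ℂ} (hf : ContDiff ℝ 2 f) (z v : ℂ) :
    fderiv ℝ (dz f) z v =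
      (fderiv ℝ (fderiv ℝ f) z v 1 - I * fderiv ℝ (fderiv ℝ f) z v I) / 2 := by
  have h : Differentiable ℝ (fderiv ℝ f) :=
    ((hf.fderiv_right (m := 1) (by norm_num)).differentiable (by norm_num))
  have h1 : DifferentiableAt ℝ (fun u => fderiv ℝ f u 1) z := by fun_prop
  have h2 : DifferentiableAt ℝ (fun u => fderiv ℝ f u I) z := by fun_prop
  unfold dz
  simp only [div_eq_mul_inv]
  rw [fderiv_mul_const (by fun_prop), fderiv_fun_sub h1 (by fun_prop), fderiv_const_mul h2]
  simp [fderiv_fderiv_apply hf, mul_comm]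

lemma fderiv_dzbar {f : ℂ → ℂ} (hf : ContDiff ℝ 2 f) (z v : ℂ) :
    fderiv ℝ (dzbar f) z v =
      (fderiv ℝ (fderiv ℝ f) z v 1 + I * fderiv ℝ (fderiv ℝ f) z v I) / 2 := by
  have h : Differentiable ℝ (fderiv ℝ f) :=
    ((hf.fderiv_right (m := 1) (by norm_num)).differentiable (by norm_num))
  have h1 : DifferentiableAt ℝ (fun u => fderiv ℝ f u 1) z := by fun_prop
  have h2 : DifferentiableAt ℝ (fun u => fderiv ℝ f u I) z := by fun_prop
  unfold dzbar
  simp only [div_eq_mul_inv]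
  rw [fderiv_mul_const (by fun_prop), fderiv_fun_add h1 (by fun_prop), fderiv_const_mul h2]
  simp [fderiv_fderiv_apply hf]
  ring

lemma dzbar_dz_comm {f : ℂ → ℂ} (hf : ContDiff ℝ 2 f) (z : ℂ) :
    dzbar (dz f) z = dz (dzbar f) z := by
  simp only [dzbar, dz]
  erw [fderiv_dz hf, fderiv_dz hf, fderiv_dzbar hf, fderiv_dzbar hf]
  rw [fderiv_fderiv_comm hf z I 1]
  ring

lemma fderiv_ofReal {f : ℂ → ℝ} {z : ℂ} (hf : DifferentiableAt ℝ f z) (v : ℂ) :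
    fderiv ℝ (fun w => (f w : ℂ)) z v = fderiv ℝ f z v := by
  have := (ofRealCLM.hasFDerivAt.comp z hf.hasFDerivAt).fderiv
  have h2 : (ofRealCLM ∘ f) = fun w => (f w : ℂ) := by ext w; simp
  rw [h2] at this
  rw [this]; simp

lemma dzbar_dz_ofReal {f : ℂ → ℝ} (hf : ContDiff ℝ 2 f) (z : ℂ) :
    dzbar (dz fun w => (f w : ℂ)) z = ((lap f z / 4 : ℝ) : ℂ) := by
  have hfd : Differentiable ℝ f := hf.differentiable (by norm_num)
  have hc : ContDiff ℝ 2 (fun w => (f w : ℂ)) := ofRealCLM.contDiff.comp hf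
  have hd : Differentiable ℝ (fderiv ℝ f) :=
    ((hf.fderiv_right (m := 1) (by norm_num)).differentiable (by norm_num))
  have key : ∀ v, fderiv ℝ (fderiv ℝ fun w => (f w : ℂ)) z v v =
      ((fderiv ℝ (fun w => fderiv ℝ f w v) z v : ℝ) : ℂ) := by
    intro v
    rw [← fderiv_fderiv_apply hc, ← fderiv_ofReal (by fun_prop)]
    congr 2
    ext w
    exact fderiv_ofReal (hfd w) v
  have : dzbar (dz fun w => (f w : ℂ)) z = (fderiv ℝ (dz fun w => (f w : ℂ)) z 1 +
    I * fderiv ℝ (dz fun w => (f w : ℂ)) z I) / 2 := rfl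
  rw [this, fderiv_dz hc, fderiv_dz hc, fderiv_fderiv_comm hc z I 1, key, key]
  simp only [lap, pdxR, pdyR]
  push_cast
  linear_combination (-(1/4) * ((fderiv ℝ (fun w => fderiv ℝ f w I) z I : ℝ) : ℂ)) * I_sq

lemma continuous_lap {f : ℂ → ℝ} (hf : ContDiff ℝ 2 f) : Continuous (lap f) := by
  have := continuous_dzbar (contDiff_one_dz (ofRealCLM.contDiff.comp hf))
  have h4 : lap f = fun z => 4 * (dzbar (dz fun w => (f w : ℂ)) z).re := by
    ext z; rw [dzbar_dz_ofReal hf, ofReal_re]; ring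
  rw [h4]
  exact continuous_const.mul (continuous_re.comp this)

lemma conj_dz_ofReal (f : ℂ → ℝ) (z : ℂ) :
    conj (dz (fun w => (f w : ℂ)) z) = dzbar (fun w => (f w : ℂ)) z := by
  rw [← dzbar_conj]; simp

lemma fderiv_exp_neg {f : ℂ → ℝ} {z : ℂ} (hf : DifferentiableAt ℝ f z) (v : ℂ) :
    fderiv ℝ (fun w => (Real.exp (-f w) : ℂ)) z v =
      - (fderiv ℝ (fun w => (f w : ℂ)) z v) * Real.exp (-f z) := by
  rw [fderiv_ofReal (by fun_prop), fderiv_ofReal hf, fderiv_exp (by fun_prop)]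
  simp [fderiv_fun_neg]
  ring

lemma dz_exp_neg {f : ℂ → ℝ} {z : ℂ} (hf : DifferentiableAt ℝ f z) :
    dz (fun w => (Real.exp (-f w) : ℂ)) z = - dz (fun w => (f w : ℂ)) z * Real.exp (-f z) := by
  simp only [dz]; rw [fderiv_exp_neg hf, fderiv_exp_neg hf]; ring

lemma dzbar_exp_neg {f : ℂ → ℝ} {z : ℂ} (hf : DifferentiableAt ℝ f z) :
    dzbar (fun w => (Real.exp (-f w) : ℂ)) z =
      - dzbar (fun w => (f w : ℂ)) z * Real.exp (-f z) := by
  simp only [dzbar]; rw [fderiv_exp_neg hf, fderiv_exp_neg hf]; ring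

lemma integral_fderiv_eq_zero {f : ℂ → ℂ} (hf : ContDiff ℝ 1 f) (hc : HasCompactSupport f)
    (v : ℂ) : ∫ z, fderiv ℝ f z v = 0 := by
  have h : Continuous fun z => fderiv ℝ f z v :=
    (hf.continuous_fderiv (by norm_num)).clm_apply continuous_const
  have hs : HasCompactSupport fun z => fderiv ℝ f z v := hc.fderiv_apply ℝ v
  have := integral_mul_fderiv_eq_neg_fderiv_mul_of_integrable (μ := volume)
    (f := fun _ : ℂ => (1 : ℂ))
    (g := f) (v := v) (by simp) (by simpa using h.integrable_of_hasCompactSupport hs)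
    (by simpa using hf.continuous.integrable_of_hasCompactSupport hc) (by simp)
    (fun x _ => hf.differentiable (by norm_num) x)
  simpa using this

lemma integrable_fderiv_apply {f : ℂ → ℂ} (hf : ContDiff ℝ 1 f) (hc : HasCompactSupport f)
    (v : ℂ) : Integrable fun z => fderiv ℝ f z v :=
  ((hf.continuous_fderiv (by norm_num)).clm_apply continuous_const).integrable_of_hasCompactSupport
    (hc.fderiv_apply ℝ v)

lemma integral_dz_eq_zero {f : ℂ → ℂ} (hf : ContDiff ℝ 1 f) (hc : HasCompactSupport f) :
    ∫ z, dz f z = 0 := by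
  simp only [dz]
  rw [integral_div, integral_sub (integrable_fderiv_apply hf hc 1)
    ((integrable_fderiv_apply hf hc I).const_mul I), integral_const_mul,
    integral_fderiv_eq_zero hf hc, integral_fderiv_eq_zero hf hc]
  simp

lemma integral_dzbar_eq_zero {f : ℂ → ℂ} (hf : ContDiff ℝ 1 f) (hc : HasCompactSupport f) :
    ∫ z, dzbar f z = 0 := by
  simp only [dzbar]
  rw [integral_div, integral_add (integrable_fderiv_apply hf hc 1)
    ((integrable_fderiv_apply hf hc I).const_mul I), integral_const_mul,
    integral_fderiv_eq_zero hf hc, integral_fderiv_eq_zero hf hc]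
  simp

/-- The formal adjoint of `∂/∂z̄` in `L²(e^{-ψ})`. -/
noncomputable def dzbarAdj (ψ : ℂ → ℝ) (α : ℂ → ℂ) (z : ℂ) : ℂ :=
  dz (fun w => (ψ w : ℂ)) z * α z - dz α z

lemma dz_exp_neg_mul {ψ : ℂ → ℝ} {α : ℂ → ℂ} {z : ℂ} (hψ : DifferentiableAt ℝ ψ z)
    (hα : DifferentiableAt ℝ α z) :
    dz (fun w => (Real.exp (-ψ w) : ℂ) * α w) z = - (dzbarAdj ψ α z * Real.exp (-ψ z)) := by
  rw [dz_mul (by fun_prop) hα, dz_exp_neg hψ, dzbarAdj]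
  ring

lemma contDiff_one_dzbarAdj {ψ : ℂ → ℝ} {α : ℂ → ℂ} (hψ : ContDiff ℝ 2 ψ)
    (hα : ContDiff ℝ 2 α) : ContDiff ℝ 1 (dzbarAdj ψ α) := by
  have h1 := contDiff_one_dz (f := fun w => (ψ w : ℂ)) (ofRealCLM.contDiff.comp hψ)
  have h2 := contDiff_one_dz hα
  have h3 : ContDiff ℝ 1 α := hα.of_le (by norm_num)
  exact (h1.mul h3).sub h2

lemma HasCompactSupport.dzbarAdj {ψ : ℂ → ℝ} {α : ℂ → ℂ} (hα : HasCompactSupport α) :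
    HasCompactSupport (dzbarAdj ψ α) :=
  HasCompactSupport.sub (hα.mul_left) hα.dz

/-- The Bochner–Kodaira–Hörmander identity, integrated form, as an inequality. -/
theorem integral_lap_mul_le {ψ : ℂ → ℝ} {α : ℂ → ℂ} (hψ : ContDiff ℝ 2 ψ)
    (hα : ContDiff ℝ 2 α) (hc : HasCompactSupport α) :
    ∫ z, lap ψ z / 4 * ‖α z‖ ^ 2 * Real.exp (-ψ z) ≤
      ∫ z, ‖dzbarAdj ψ α z‖ ^ 2 * Real.exp (-ψ z) := by
  have hψc : ContDiff ℝ 2 fun w => (ψ w : ℂ) := ofRealCLM.contDiff.comp hψ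
  have hψd : Differentiable ℝ ψ := hψ.differentiable (by norm_num)
  have hψ1 : ContDiff ℝ 1 ψ := hψ.of_le (by norm_num)
  have hα1 : ContDiff ℝ 1 α := hα.of_le (by norm_num)
  have hαd : Differentiable ℝ α := hα.differentiable (by norm_num)
  have hδ := contDiff_one_dzbarAdj hψ hα
  have hδd : Differentiable ℝ (dzbarAdj ψ α) := hδ.differentiable (by norm_num)
  have hw : ContDiff ℝ 1 fun w => (Real.exp (-ψ w) : ℂ) :=
    ofRealCLM.contDiff.comp (Real.contDiff_exp.comp hψ1.neg)
  have hwd : Differentiable ℝ fun w => (Real.exp (-ψ w) : ℂ) := hw.differentiable (by norm_num)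
  have hαc : ContDiff ℝ 1 fun w => conj (α w) := conjCLE.contDiff.comp hα1
  have hαcd : Differentiable ℝ fun w => conj (α w) := hαc.differentiable (by norm_num)
  have hαcc : HasCompactSupport fun w => conj (α w) := hc.comp_left (g := conj) (by simp)
  have hdz := contDiff_one_dz hα
  have hdzd : Differentiable ℝ (dz α) := hdz.differentiable (by norm_num)
  have hdzb := contDiff_one_dzbar hα
  have hdzbd : Differentiable ℝ (dzbar α) := hdzb.differentiable (by norm_num)
  have hψz := contDiff_one_dz hψc
  have hψzd : Differentiable ℝ (dz fun w => (ψ w : ℂ)) := hψz.differentiable (by norm_num)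
  set P : ℂ → ℂ := fun w => dzbarAdj ψ α w * (conj (α w) * Real.exp (-ψ w)) with hP
  set Q : ℂ → ℂ := fun w => dzbar α w * (conj (α w) * Real.exp (-ψ w)) with hQ
  have hP1 : ContDiff ℝ 1 P := hδ.mul (hαc.mul hw)
  have hQ1 : ContDiff ℝ 1 Q := hdzb.mul (hαc.mul hw)
  have hPc : HasCompactSupport P := HasCompactSupport.mul_left (HasCompactSupport.mul_right hαcc)
  have hQc : HasCompactSupport Q := HasCompactSupport.mul_left (HasCompactSupport.mul_right hαcc)
  have key : ∀ z, dzbar P z + dz Q z =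
      ((lap ψ z / 4 * ‖α z‖ ^ 2 * Real.exp (-ψ z) + ‖dzbar α z‖ ^ 2 * Real.exp (-ψ z) -
        ‖dzbarAdj ψ α z‖ ^ 2 * Real.exp (-ψ z) : ℝ) : ℂ) := by
    intro z
    have e1 : dzbar P z = dzbar (dzbarAdj ψ α) z * (conj (α z) * Real.exp (-ψ z)) +
        dzbarAdj ψ α z * (conj (dz α z) * Real.exp (-ψ z) + conj (α z) *
          (- dzbar (fun w => (ψ w : ℂ)) z * Real.exp (-ψ z))) := by
      rw [hP, dzbar_mul (hδd z) ((hαcd z).fun_mul (hwd z)), dzbar_mul (hαcd z) (hwd z),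
        dzbar_conj, dzbar_exp_neg (hψd z)]
    have e2 : dz Q z = dz (dzbar α) z * (conj (α z) * Real.exp (-ψ z)) +
        dzbar α z * (conj (dzbar α z) * Real.exp (-ψ z) + conj (α z) *
          (- dz (fun w => (ψ w : ℂ)) z * Real.exp (-ψ z))) := by
      rw [hQ, dz_mul (hdzbd z) ((hαcd z).fun_mul (hwd z)), dz_mul (hαcd z) (hwd z),
        dz_conj, dz_exp_neg (hψd z)]
    have e3 : dzbar (dzbarAdj ψ α) z = ((lap ψ z / 4 : ℝ) : ℂ) * α z +
        dz (fun w => (ψ w : ℂ)) z * dzbar α z - dz (dzbar α) z := by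
      have : dzbarAdj ψ α = fun w => dz (fun w => (ψ w : ℂ)) w * α w - dz α w := rfl
      rw [this, dzbar_sub ((hψzd z).fun_mul (hαd z)) (hdzd z), dzbar_mul (hψzd z) (hαd z),
        dzbar_dz_ofReal hψ, dzbar_dz_comm hα]
    have e4 : conj (dzbarAdj ψ α z) = dzbar (fun w => (ψ w : ℂ)) z * conj (α z) -
        conj (dz α z) := by
      rw [dzbarAdj, map_sub, map_mul, conj_dz_ofReal]
    have n (u : ℂ) : ((‖u‖ : ℂ)) ^ 2 = u * conj u := (mul_conj' u).symm
    rw [e1, e2, e3]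
    push_cast
    rw [n, n, n, e4]
    ring
  have iP := integral_dzbar_eq_zero hP1 hPc
  have iQ := integral_dz_eq_zero hQ1 hQc
  have hsum : ∫ z, (dzbar P z + dz Q z) = 0 := by
    rw [integral_add ((continuous_dzbar hP1).integrable_of_hasCompactSupport hPc.dzbar)
      ((continuous_dz hQ1).integrable_of_hasCompactSupport hQc.dz), iP, iQ, add_zero]
  simp_rw [key] at hsum
  rw [integral_complex_ofReal, ofReal_eq_zero] at hsum
  have sq (f : ℂ → ℂ) (hf : HasCompactSupport f) :
      HasCompactSupport fun z => ‖f z‖ ^ 2 * Real.exp (-ψ z) :=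
    HasCompactSupport.mul_right (hf.comp_left (g := fun u => ‖u‖ ^ 2) (by simp))
  have hexp_cont : Continuous fun z => Real.exp (-ψ z) := by fun_prop
  have clap : Continuous (lap ψ) := continuous_lap hψ
  have i1 : Integrable fun z => lap ψ z / 4 * ‖α z‖ ^ 2 * Real.exp (-ψ z) := by
    refine Continuous.integrable_of_hasCompactSupport (by fun_prop) ?_
    simp_rw [mul_assoc]
    exact (sq α hc).mul_left
  have i2 : Integrable fun z => ‖dzbar α z‖ ^ 2 * Real.exp (-ψ z) :=
    Continuous.integrable_of_hasCompactSupport (by fun_prop) (sq _ hc.dzbar)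
  have i3 : Integrable fun z => ‖dzbarAdj ψ α z‖ ^ 2 * Real.exp (-ψ z) :=
    Continuous.integrable_of_hasCompactSupport (by fun_prop) (sq _ hc.dzbarAdj)
  have i12 : Integrable fun z => lap ψ z / 4 * ‖α z‖ ^ 2 * Real.exp (-ψ z) +
      ‖dzbar α z‖ ^ 2 * Real.exp (-ψ z) := i1.add i2
  rw [integral_sub i12 i3, integral_add i1 i2] at hsum
  have pos : 0 ≤ ∫ z, ‖dzbar α z‖ ^ 2 * Real.exp (-ψ z) :=
    integral_nonneg fun z => by positivity
  linarith

section Weyl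

open Filter Topology
open scoped Convolution

/-- The mean value property of entire functions with respect to radial weights. -/
lemma integral_radial_smul_entire {ρ : ℂ → ℝ} (hρ : Continuous ρ) (hc : HasCompactSupport ρ)
    (hrad : ∀ z w : ℂ, ‖z‖ = ‖w‖ → ρ z = ρ w) {G : ℂ → ℂ} (hG : Differentiable ℂ G) (z : ℂ) :
    ∫ t, ρ t • G (z - t) = (∫ t, ρ t) • G z := by
  have hGc : Continuous G := hG.continuous
  have rot (θ : ℝ) : ∫ t, ρ t • G (z - t) = ∫ t, ρ t • G (z - exp (θ * I) * t) := by
    have := (rotation (Circle.exp θ)).measurePreserving.integral_comp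
      (rotation (Circle.exp θ)).toHomeomorph.measurableEmbedding (fun t => ρ t • G (z - t))
    rw [← this]
    congr 1
    ext t
    simp only [rotation_apply, Circle.coe_exp]
    rw [hrad (exp (θ * I) * t) t (by simp [norm_exp_ofReal_mul_I])]
  have avg (t : ℂ) : ∫ θ in (0 : ℝ)..2 * Real.pi, G (z - exp (θ * I) * t) =
      (2 * Real.pi) • G z := by
    have hH : Differentiable ℂ fun u => G (z - u * t) := by fun_prop
    have h := (hH.diffContOnCl (s := Metric.ball 0 |1|)).circleAverage
    rw [Real.circleAverage_def, inv_smul_eq_iff₀ (by positivity)] at h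
    simpa [circleMap] using h
  have hInt : Integrable (Function.uncurry fun (θ : ℝ) (t : ℂ) => ρ t • G (z - exp (θ * I) * t))
      ((volume.restrict (Set.uIoc 0 (2 * Real.pi))).prod volume) := by
    have hcont : Continuous (Function.uncurry fun (θ : ℝ) (t : ℂ) =>
        ρ t • G (z - exp (θ * I) * t)) := by
      unfold Function.uncurry; fun_prop
    have : IntegrableOn (Function.uncurry fun (θ : ℝ) (t : ℂ) => ρ t • G (z - exp (θ * I) * t))
        (Set.uIcc 0 (2 * Real.pi) ×ˢ tsupport ρ) (volume.prod volume) :=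
      hcont.continuousOn.integrableOn_compact (isCompact_uIcc.prod hc)
    have h2 : IntegrableOn (Function.uncurry fun (θ : ℝ) (t : ℂ) => ρ t • G (z - exp (θ * I) * t))
        (Set.uIoc 0 (2 * Real.pi) ×ˢ Set.univ) (volume.prod volume) := by
      refine (this.mono_set (Set.prod_mono_left Set.uIoc_subset_uIcc)).of_forall_sdiff_eq_zero
        (measurableSet_uIoc.prod MeasurableSet.univ) ?_
      rintro ⟨θ, t⟩ ⟨⟨h1, -⟩, h2⟩
      have : t ∉ tsupport ρ := fun ht => h2 ⟨h1, ht⟩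
      simp [Function.uncurry, image_eq_zero_of_notMem_tsupport this]
    rwa [IntegrableOn, ← Measure.prod_restrict, Measure.restrict_univ] at h2
  have swap := intervalIntegral_integral_swap hInt
  have lhs : ∫ θ in (0 : ℝ)..2 * Real.pi, ∫ t, ρ t • G (z - exp (θ * I) * t) =
      (2 * Real.pi) • ∫ t, ρ t • G (z - t) := by
    simp_rw [← rot]
    simp
  rw [lhs] at swap
  simp_rw [intervalIntegral.integral_smul, avg, smul_comm _ (2 * Real.pi)] at swap
  rw [integral_smul, integral_smul_const] at swap
  exact smul_right_injective ℂ (r := 2 * Real.pi) (by positivity) swap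

lemma exists_radial_mollifier : ∃ ρ : ℂ → ℝ, ContDiff ℝ 2 ρ ∧ HasCompactSupport ρ ∧
    (∀ z w : ℂ, ‖z‖ = ‖w‖ → ρ z = ρ w) ∧ ∫ z, ρ z = 1 := by
  set κ : ℂ → ℝ := fun z => Real.smoothTransition (1 - ‖z‖ ^ 2) with hκ
  have hκs : ContDiff ℝ 2 κ :=
    Real.smoothTransition.contDiff.comp (contDiff_const.sub (contDiff_norm_sq ℝ))
  have hκc : HasCompactSupport κ := by
    refine HasCompactSupport.intro (isCompact_closedBall (0 : ℂ) 1) fun z hz => ?_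
    simp only [Metric.mem_closedBall, dist_zero_right, not_le] at hz
    exact Real.smoothTransition.zero_of_nonpos (by nlinarith)
  have hpos : 0 < ∫ z, κ z :=
    hκs.continuous.integral_pos_of_hasCompactSupport_nonneg_nonzero hκc
      (fun z => Real.smoothTransition.nonneg _) (x := 0) (by simp [hκ])
  refine ⟨fun z => (∫ w, κ w)⁻¹ * κ z, contDiff_const.mul hκs, hκc.mul_left, ?_, ?_⟩
  · intro z w h
    simp [hκ, h]
  · rw [integral_const_mul, inv_mul_cancel₀ hpos.ne']

lemma differentiable_convolution_of_weak_dzbar_eq_zero {F : ℂ → ℂ} (hF : LocallyIntegrable F)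
    (h : ∀ γ : ℂ → ℂ, ContDiff ℝ 2 γ → HasCompactSupport γ → ∫ z, F z * dzbar γ z = 0)
    {ρ : ℂ → ℝ} (hρ : ContDiff ℝ 2 ρ) (hc : HasCompactSupport ρ) :
    Differentiable ℂ (ρ ⋆[ContinuousLinearMap.lsmul ℝ ℝ, volume] F) := by
  intro z
  have hd := hc.hasFDerivAt_convolution_left (ContinuousLinearMap.lsmul ℝ ℝ)
    (hρ.of_le (by norm_num)) hF z
  have hex := (hc.fderiv ℝ).convolutionExists_left
    ((ContinuousLinearMap.lsmul ℝ ℝ : ℝ →L[ℝ] ℂ →L[ℝ] ℂ).precompL ℂ)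
    (hρ.continuous_fderiv (by norm_num)) hF z
  have val (v : ℂ) : fderiv ℝ (ρ ⋆[ContinuousLinearMap.lsmul ℝ ℝ, volume] F) z v =
      ∫ s, (fderiv ℝ ρ (z - s) v : ℂ) * F s := by
    rw [hd.fderiv, convolution_def, ContinuousLinearMap.integral_apply hex]
    rw [← integral_sub_left_eq_self _ volume z]
    simp
  have hInt (v : ℂ) : Integrable fun s => (fderiv ℝ ρ (z - s) v : ℂ) * F s := by
    have := (hex.apply_continuousLinearMap v).comp_sub_left z
    simpa using this
  rw [differentiableAt_complex_iff_differentiableAt_real]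
  refine ⟨hd.differentiableAt, ?_⟩
  have hγ : ContDiff ℝ 2 fun s => (ρ (z - s) : ℂ) :=
    ofRealCLM.contDiff.comp (hρ.comp (contDiff_const.sub contDiff_id))
  have hγc : HasCompactSupport fun s => (ρ (z - s) : ℂ) := by
    have : HasCompactSupport fun s => ρ (z - s) := hc.comp_homeomorph (Homeomorph.subLeft z)
    exact this.comp_left (g := fun x : ℝ => (x : ℂ)) (by simp)
  have h0 := h _ hγ hγc
  have hρd : Differentiable ℝ ρ := hρ.differentiable (by norm_num)
  have e (s v : ℂ) : fderiv ℝ (fun s => (ρ (z - s) : ℂ)) s v = -(fderiv ℝ ρ (z - s) v : ℂ) := by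
    rw [fderiv_ofReal (by fun_prop)]
    have := ((hρd (z - s)).hasFDerivAt.comp s ((hasFDerivAt_id s).const_sub z)).fderiv
    simp only [Function.comp_def] at this
    rw [this]; simp
  have e2 : (fun s => F s * dzbar (fun s => (ρ (z - s) : ℂ)) s) = fun s =>
      (-1 / 2 : ℂ) * ((fderiv ℝ ρ (z - s) 1 : ℂ) * F s) +
        (-I / 2) * ((fderiv ℝ ρ (z - s) I : ℂ) * F s) := by
    ext s; simp only [dzbar, e]; ring
  rw [e2, integral_add ((hInt 1).const_mul _) ((hInt I).const_mul _), integral_const_mul,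
    integral_const_mul, ← val, ← val] at h0
  rw [smul_eq_mul]
  linear_combination (2 * I) * h0 +
    (fderiv ℝ (ρ ⋆[ContinuousLinearMap.lsmul ℝ ℝ, volume] F) z I) * I_sq

/-- Weyl's lemma for the Cauchy–Riemann operator. -/
theorem exists_entire_ae_eq {F : ℂ → ℂ} (hF : LocallyIntegrable F)
    (h : ∀ γ : ℂ → ℂ, ContDiff ℝ 2 γ → HasCompactSupport γ → ∫ z, F z * dzbar γ z = 0) :
    ∃ f : ℂ → ℂ, Differentiable ℂ f ∧ F =ᵐ[volume] f := by
  obtain ⟨ρ, hρ, hρc, hρr, hρ1⟩ := exists_radial_mollifier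
  set L : ℝ →L[ℝ] ℂ →L[ℝ] ℂ := ContinuousLinearMap.lsmul ℝ ℝ
  have hFn : LocallyIntegrable fun x => ‖F x‖ := fun x => (hF x).norm
  have mean {G : ℂ → ℂ} (hG : Differentiable ℂ G) : ρ ⋆[L, volume] G = G := by
    ext z
    have := integral_radial_smul_entire hρ.continuous hρc hρr hG z
    rw [hρ1, one_smul] at this
    exact this
  have assoc {k l : ℂ → ℝ} (hk : Continuous k) (hl : Continuous l) (hkc : HasCompactSupport k)
      (hlc : HasCompactSupport l) : (k ⋆[ContinuousLinearMap.mul ℝ ℝ, volume] l)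
        ⋆[L, volume] F = k ⋆[L, volume] (l ⋆[L, volume] F) := by
    ext z
    refine convolution_assoc _ _ _ _ (fun x y z => by simp [L, mul_assoc])
      hk.aestronglyMeasurable hl.aestronglyMeasurable hF.aestronglyMeasurable ?_ ?_ ?_
    · exact .of_forall (hkc.convolutionExists_left _ hk hl.locallyIntegrable)
    · exact .of_forall (hlc.norm.convolutionExists_left _ hl.norm hFn)
    · exact hkc.norm.convolutionExists_left _ hk.norm
        (hlc.norm.continuous_convolution_left _ hl.norm hFn).locallyIntegrable z
  have comm (b : ContDiffBump (0 : ℂ)) : b.normed volume ⋆[L, volume] F =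
      b.normed volume ⋆[L, volume] (ρ ⋆[L, volume] F) := by
    have hol := differentiable_convolution_of_weak_dzbar_eq_zero hF h b.contDiff_normed
      (b.hasCompactSupport_normed (μ := volume))
    rw [← mean hol, ← assoc hρ.continuous b.continuous_normed hρc b.hasCompactSupport_normed,
      ← assoc b.continuous_normed hρ.continuous b.hasCompactSupport_normed hρc,
      ← convolution_flip (f := ρ) (g := b.normed volume), ContinuousLinearMap.flip_mul]
  let b (n : ℕ) : ContDiffBump (0 : ℂ) :=
    ⟨1 / (n + 1), 2 * (1 / (n + 1)), by positivity, by
      have : (0 : ℝ) < 1 / (n + 1) := by positivity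
      linarith⟩
  have hb : Tendsto (fun n => (b n).rOut) atTop (𝓝 0) := by
    have := tendsto_one_div_add_atTop_nhds_zero_nat.const_mul (2 : ℝ)
    rw [mul_zero] at this
    exact this
  have hlim := ContDiffBump.ae_convolution_tendsto_right_of_locallyIntegrable (μ := volume)
    (φ := b) (l := atTop) (K := 2) hb (.of_forall fun n => le_rfl) hF
  have hf := differentiable_convolution_of_weak_dzbar_eq_zero hF h hρ hρc
  refine ⟨_, hf, ?_⟩
  filter_upwards [hlim] with z hz
  refine tendsto_nhds_unique hz ?_
  simp_rw [L] at comm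
  simp_rw [comm]
  exact ContDiffBump.convolution_tendsto_right_of_continuous hb hf.continuous z

end Weyl

section Hormander

open scoped InnerProductSpace

lemma Lp_two_norm_sq {g : Lp ℂ 2 (volume : Measure ℂ)} {u : ℂ → ℂ} (h : g =ᵐ[volume] u) :
    ‖g‖ ^ 2 = ∫ z, ‖u z‖ ^ 2 := by
  have h1 : (⟪g, g⟫_ℂ) = ((∫ z, ‖u z‖ ^ 2 : ℝ) : ℂ) := by
    rw [L2.inner_def, ← integral_complex_ofReal]
    refine integral_congr_ae ?_
    filter_upwards [h] with z hz
    rw [hz]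
    simp [inner_self_eq_norm_sq_to_K]
  rw [inner_self_eq_norm_sq_to_K] at h1
  exact ofReal_injective (by rw [← h1]; push_cast; rfl)

lemma integral_mul_le_sqrt_mul_sqrt {f g : ℂ → ℝ} (hf : Continuous f) (hg : Continuous g)
    (hfc : HasCompactSupport f) (hgc : HasCompactSupport g) (hf0 : ∀ z, 0 ≤ f z)
    (hg0 : ∀ z, 0 ≤ g z) :
    ∫ z, f z * g z ≤ √(∫ z, f z ^ 2) * √(∫ z, g z ^ 2) := by
  have h := integral_mul_le_Lp_mul_Lq_of_nonneg (μ := volume) Real.HolderConjugate.two_two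
    (.of_forall hf0) (.of_forall hg0) (hf.memLp_of_hasCompactSupport hfc)
    (hg.memLp_of_hasCompactSupport hgc)
  simpa [Real.sqrt_eq_rpow] using h

lemma exp_half_mul_self (x : ℝ) : Real.exp (-x / 2) * Real.exp (-x / 2) = Real.exp (-x) := by
  rw [← Real.exp_add]; ring_nf

/-- The a priori estimate dual to Hörmander's `L²` estimate. -/
lemma norm_integral_mul_dzbarAdj_le {ψ : ℂ → ℝ} (hψ : ContDiff ℝ 2 ψ) (hlap : ∀ z, 0 < lap ψ z)
    {χ : ℂ → ℂ} (hχ : ContDiff ℝ 2 χ) (hχc : HasCompactSupport χ)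
    {α : ℂ → ℂ} (hα : ContDiff ℝ 2 α) (hc : HasCompactSupport α) :
    ‖∫ z, χ z * (dzbarAdj ψ α z * Real.exp (-ψ z))‖ ≤
      √(∫ z, ‖dz χ z‖ ^ 2 / (lap ψ z / 4) * Real.exp (-ψ z)) *
        √(∫ z, ‖dzbarAdj ψ α z‖ ^ 2 * Real.exp (-ψ z)) := by
  have hψd : Differentiable ℝ ψ := hψ.differentiable (by norm_num)
  have hψ1 : ContDiff ℝ 1 ψ := hψ.of_le (by norm_num)
  have hψc : Continuous ψ := hψ.continuous
  have hαc : Continuous α := hα.continuous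
  have hα1 : ContDiff ℝ 1 α := hα.of_le (by norm_num)
  have hχ1 : ContDiff ℝ 1 χ := hχ.of_le (by norm_num)
  have hαd : Differentiable ℝ α := hα.differentiable (by norm_num)
  have hχd : Differentiable ℝ χ := hχ.differentiable (by norm_num)
  have hw : ContDiff ℝ 1 fun w => (Real.exp (-ψ w) : ℂ) :=
    ofRealCLM.contDiff.comp (Real.contDiff_exp.comp hψ1.neg)
  have hwα : ContDiff ℝ 1 fun w => (Real.exp (-ψ w) : ℂ) * α w := hw.mul hα1
  have hwαd : Differentiable ℝ fun w => (Real.exp (-ψ w) : ℂ) * α w :=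
    hwα.differentiable (by norm_num)
  have hlc := continuous_lap hψ
  have hdχ := continuous_dz hχ1
  have hδ := (contDiff_one_dzbarAdj hψ hα).continuous
  have h0 := integral_dz_eq_zero (hχ1.mul hwα) hχc.mul_right
  have e : ∀ z, dz (fun w => χ w * ((Real.exp (-ψ w) : ℂ) * α w)) z =
      dz χ z * (Real.exp (-ψ z) * α z) - χ z * (dzbarAdj ψ α z * Real.exp (-ψ z)) := by
    intro z
    rw [dz_mul (hχd z) (hwαd z), dz_exp_neg_mul (hψd z) (hαd z)]
    ring
  simp_rw [e] at h0
  have hexp_cont : Continuous fun z => (Real.exp (-ψ z) : ℂ) := hw.continuous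
  rw [integral_sub, sub_eq_zero] at h0
  rotate_left
  · exact Continuous.integrable_of_hasCompactSupport (by fun_prop) hχc.dz.mul_right
  · exact Continuous.integrable_of_hasCompactSupport (by fun_prop) hχc.mul_right
  rw [← h0]
  have hq : ∀ z, 0 < lap ψ z / 4 := fun z => by linarith [hlap z]
  have hq' : ∀ z, √(lap ψ z / 4) ≠ 0 := fun z => (Real.sqrt_pos.2 (hq z)).ne'
  calc ‖∫ z, dz χ z * (Real.exp (-ψ z) * α z)‖
      ≤ ∫ z, ‖dz χ z * (Real.exp (-ψ z) * α z)‖ := norm_integral_le_integral_norm _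
    _ = ∫ z, (‖dz χ z‖ / √(lap ψ z / 4) * Real.exp (-ψ z / 2)) *
          (√(lap ψ z / 4) * ‖α z‖ * Real.exp (-ψ z / 2)) := by
        congr 1
        ext z
        rw [norm_mul, norm_mul, norm_real, Real.norm_of_nonneg (Real.exp_pos _).le,
          ← exp_half_mul_self]
        have := hq' z
        field_simp
    _ ≤ _ := integral_mul_le_sqrt_mul_sqrt
        (((hdχ.norm).div (by fun_prop) hq').mul (by fun_prop)) (by fun_prop)
        ?_ ?_ (fun z => by positivity) (fun z => by positivity)
    _ ≤ _ := ?_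
  · refine hχc.dz.mono fun z hz => ?_
    contrapose! hz
    simp only [Function.mem_support, not_not] at hz ⊢
    simp [hz]
  · refine hc.mono fun z hz => ?_
    contrapose! hz
    simp only [Function.mem_support, not_not] at hz ⊢
    simp [hz]
  · have e1 : ∀ z, (‖dz χ z‖ / √(lap ψ z / 4) * Real.exp (-ψ z / 2)) ^ 2 =
        ‖dz χ z‖ ^ 2 / (lap ψ z / 4) * Real.exp (-ψ z) := fun z => by
      rw [mul_pow, div_pow, Real.sq_sqrt (hq z).le, sq (Real.exp _), exp_half_mul_self]
    have e2 : ∀ z, (√(lap ψ z / 4) * ‖α z‖ * Real.exp (-ψ z / 2)) ^ 2 =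
        lap ψ z / 4 * ‖α z‖ ^ 2 * Real.exp (-ψ z) := fun z => by
      rw [mul_pow, mul_pow, Real.sq_sqrt (hq z).le, sq (Real.exp _), exp_half_mul_self]
    simp_rw [e1, e2]
    exact mul_le_mul_of_nonneg_left (Real.sqrt_le_sqrt (integral_lap_mul_le hψ hα hc))
      (Real.sqrt_nonneg _)

lemma dzbarAdj_add {ψ : ℂ → ℝ} {α β : ℂ → ℂ} {z : ℂ} (hα : DifferentiableAt ℝ α z)
    (hβ : DifferentiableAt ℝ β z) :
    dzbarAdj ψ (fun w => α w + β w) z = dzbarAdj ψ α z + dzbarAdj ψ β z := by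
  simp only [dzbarAdj, dz, fderiv_fun_add hα hβ, _root_.add_apply]
  ring

lemma dzbarAdj_const_mul {ψ : ℂ → ℝ} {α : ℂ → ℂ} {z : ℂ} (hα : DifferentiableAt ℝ α z) (c : ℂ) :
    dzbarAdj ψ (fun w => c * α w) z = c * dzbarAdj ψ α z := by
  simp only [dzbarAdj, dz, fderiv_const_mul hα, _root_.smul_apply, smul_eq_mul]
  ring

/-- The image of the test functions under the adjoint of `∂/∂z̄`, transported to the unweighted
`L²` space. -/
noncomputable def dzbarAdjRange (ψ : ℂ → ℝ) : Submodule ℂ (Lp ℂ 2 (volume : Measure ℂ)) where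
  carrier := {g | ∃ α : ℂ → ℂ, ContDiff ℝ 2 α ∧ HasCompactSupport α ∧
    g =ᵐ[volume] fun z => dzbarAdj ψ α z * Real.exp (-ψ z / 2)}
  add_mem' := by
    rintro g h ⟨α, hα, hαc, hg⟩ ⟨β, hβ, hβc, hh⟩
    refine ⟨fun w => α w + β w, hα.add hβ, hαc.add hβc, ?_⟩
    filter_upwards [Lp.coeFn_add g h, hg, hh] with z h1 h2 h3
    rw [h1, Pi.add_apply, h2, h3, dzbarAdj_add (hα.differentiable (by norm_num) z)
      (hβ.differentiable (by norm_num) z)]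
    ring
  zero_mem' := by
    refine ⟨fun _ => 0, contDiff_const, HasCompactSupport.zero, ?_⟩
    filter_upwards [Lp.coeFn_zero ℂ 2 (volume : Measure ℂ)] with z h1
    rw [h1]
    simp [dzbarAdj, dz]
  smul_mem' := by
    rintro c g ⟨α, hα, hαc, hg⟩
    refine ⟨fun w => c * α w, contDiff_const.mul hα, hαc.mul_left, ?_⟩
    filter_upwards [Lp.coeFn_smul c g, hg] with z h1 h2
    rw [h1, Pi.smul_apply, h2, dzbarAdj_const_mul (hα.differentiable (by norm_num) z),
      smul_eq_mul]
    ring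

lemma continuous_mul_exp_half {ψ : ℂ → ℝ} (hψ : Continuous ψ) {u : ℂ → ℂ} (hu : Continuous u) :
    Continuous fun z => u z * Real.exp (-ψ z / 2) :=
  hu.mul (continuous_ofReal.comp (by fun_prop))

lemma norm_mul_exp_half_sq (u : ℂ) (x : ℝ) :
    ‖u * Real.exp (-x / 2)‖ ^ 2 = ‖u‖ ^ 2 * Real.exp (-x) := by
  rw [norm_mul, norm_real, Real.norm_of_nonneg (Real.exp_pos _).le, mul_pow, sq (Real.exp _),
    exp_half_mul_self]

lemma orthogonal_dzbarAdjRange_ne_bot {ψ : ℂ → ℝ} (hψ : ContDiff ℝ 2 ψ)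
    (hlap : ∀ z, 0 < lap ψ z) {χ : ℂ → ℂ} (hχ : ContDiff ℝ 2 χ) (hχc : HasCompactSupport χ)
    (hlt : ∫ z, ‖dz χ z‖ ^ 2 / (lap ψ z / 4) * Real.exp (-ψ z) <
      ∫ z, ‖χ z‖ ^ 2 * Real.exp (-ψ z)) : (dzbarAdjRange ψ)ᗮ ≠ ⊥ := by
  intro hbot
  rw [← Submodule.topologicalClosure_eq_top_iff] at hbot
  have hXm : MemLp (fun z => conj (χ z) * Real.exp (-ψ z / 2)) 2 (volume : Measure ℂ) :=
    (continuous_mul_exp_half hψ.continuous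
      (continuous_conj.comp hχ.continuous)).memLp_of_hasCompactSupport
      (HasCompactSupport.mul_right (hχc.comp_left (g := conj) (by simp)))
  set X : Lp ℂ 2 (volume : Measure ℂ) := hXm.toLp with hX
  have hXe : X =ᵐ[volume] fun z => conj (χ z) * Real.exp (-ψ z / 2) := hXm.coeFn_toLp
  set A : ℝ := √(∫ z, ‖dz χ z‖ ^ 2 / (lap ψ z / 4) * Real.exp (-ψ z)) with hA
  have hXn : ‖X‖ ^ 2 = ∫ z, ‖χ z‖ ^ 2 * Real.exp (-ψ z) := by
    rw [Lp_two_norm_sq hXe]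
    simp_rw [norm_mul_exp_half_sq, norm_conj]
  have bound : ∀ g ∈ dzbarAdjRange ψ, ‖⟪X, g⟫_ℂ‖ ≤ A * ‖g‖ := by
    rintro g ⟨α, hα, hαc, hg⟩
    have hgn : ‖g‖ = √(∫ z, ‖dzbarAdj ψ α z‖ ^ 2 * Real.exp (-ψ z)) := by
      rw [← Real.sqrt_sq (norm_nonneg g), Lp_two_norm_sq hg]
      simp_rw [norm_mul_exp_half_sq]
    rw [hgn]
    refine le_of_eq_of_le (congrArg norm ?_) (norm_integral_mul_dzbarAdj_le hψ hlap hχ hχc hα hαc)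
    rw [L2.inner_def]
    refine integral_congr_ae ?_
    filter_upwards [hXe, hg] with z h1 h2
    rw [h1, h2, ← exp_half_mul_self]
    simp only [RCLike.inner_apply, map_mul, conj_conj, conj_ofReal, ofReal_mul]
    ring
  have hXmem : X ∈ closure (dzbarAdjRange ψ : Set (Lp ℂ 2 (volume : Measure ℂ))) := by
    rw [← Submodule.topologicalClosure_coe, hbot]; trivial
  have hcl : IsClosed {g : Lp ℂ 2 (volume : Measure ℂ) | ‖⟪X, g⟫_ℂ‖ ≤ A * ‖g‖} :=
    isClosed_le (by fun_prop) (by fun_prop)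
  have hXX : ‖⟪X, X⟫_ℂ‖ ≤ A * ‖X‖ := closure_minimal (t := {g | ‖⟪X, g⟫_ℂ‖ ≤ A * ‖g‖})
    bound hcl hXmem
  have h1 : ‖X‖ ^ 2 ≤ A * ‖X‖ := by
    refine le_trans (le_of_eq ?_) hXX
    rw [inner_self_eq_norm_sq_to_K]
    simp
  have h0 : 0 ≤ ∫ z, ‖dz χ z‖ ^ 2 / (lap ψ z / 4) * Real.exp (-ψ z) :=
    integral_nonneg fun z => by have := hlap z; positivity
  have hA2 : A ^ 2 < ‖X‖ ^ 2 := by rw [hA, Real.sq_sqrt h0, hXn]; exact hlt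
  have hA0 : 0 ≤ A := Real.sqrt_nonneg _
  have := abs_lt_of_sq_lt_sq' hA2 (norm_nonneg X)
  nlinarith [this.2]

/-- A nonzero entire function square integrable with respect to a strictly subharmonic weight
exists as soon as the weight has a suitable cutoff function. -/
theorem exists_entire_of_cutoff {ψ : ℂ → ℝ} (hψ : ContDiff ℝ 2 ψ)
    (hlap : ∀ z, 0 < lap ψ z) {χ : ℂ → ℂ} (hχ : ContDiff ℝ 2 χ) (hχc : HasCompactSupport χ)
    (hlt : ∫ z, ‖dz χ z‖ ^ 2 / (lap ψ z / 4) * Real.exp (-ψ z) <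
      ∫ z, ‖χ z‖ ^ 2 * Real.exp (-ψ z)) :
    ∃ f : ℂ → ℂ, Differentiable ℂ f ∧ f ≠ 0 ∧
      Integrable fun z => ‖f z‖ ^ 2 * Real.exp (-ψ z) := by
  obtain ⟨G, hG, hG0⟩ := Submodule.exists_mem_ne_zero_of_ne_bot
    (orthogonal_dzbarAdjRange_ne_bot hψ hlap hχ hχc hlt)
  have hψc := hψ.continuous
  have hψd : Differentiable ℝ ψ := hψ.differentiable (by norm_num)
  set F : ℂ → ℂ := fun z => G z * (Real.exp (ψ z / 2) : ℂ) with hF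
  have hFG : ∀ z, F z * Real.exp (-ψ z / 2) = G z := fun z => by
    rw [hF, mul_assoc, ← ofReal_mul, ← Real.exp_add]
    ring_nf
    simp
  have hGm : MemLp G 2 volume := Lp.memLp G
  have hFloc : LocallyIntegrable F := by
    rw [locallyIntegrable_iff]
    intro K hK
    refine ((hGm.locallyIntegrable (by norm_num)).integrableOn_isCompact hK).mul_continuousOn
      (Continuous.continuousOn ?_) hK
    exact continuous_ofReal.comp (by fun_prop)
  obtain ⟨f, hf, hFf⟩ := exists_entire_ae_eq hFloc fun γ hγ hγc => by
    set α : ℂ → ℂ := fun w => (Real.exp (ψ w) : ℂ) * conj (γ w) with hα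
    have hα2 : ContDiff ℝ 2 α :=
      (ofRealCLM.contDiff.comp (Real.contDiff_exp.comp hψ)).mul (conjCLE.contDiff.comp hγ)
    have hαc : HasCompactSupport α :=
      HasCompactSupport.mul_left (hγc.comp_left (g := conj) (by simp))
    have hαd : Differentiable ℝ α := hα2.differentiable (by norm_num)
    have hexp_cont : Continuous fun z => dzbarAdj ψ α z * (Real.exp (-ψ z / 2) : ℂ) :=
      continuous_mul_exp_half hψc (contDiff_one_dzbarAdj hψ hα2).continuous
    have hm : MemLp (fun z => dzbarAdj ψ α z * (Real.exp (-ψ z / 2) : ℂ)) 2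
        (volume : Measure ℂ) :=
      hexp_cont.memLp_of_hasCompactSupport hαc.dzbarAdj.mul_right
    have horth := (Submodule.mem_orthogonal _ _).1 hG hm.toLp ⟨α, hα2, hαc, hm.coeFn_toLp⟩
    rw [L2.inner_def] at horth
    rw [← neg_eq_zero, ← horth, ← integral_neg]
    refine integral_congr_ae ?_
    filter_upwards [hm.coeFn_toLp] with z hz
    have e1 : (fun w => (Real.exp (-ψ w) : ℂ) * α w) = fun w => conj (γ w) := by
      ext w
      rw [hα, ← mul_assoc, ← ofReal_mul, ← Real.exp_add]
      simp
    have e2 := dz_exp_neg_mul (hψd z) (hαd z)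
    rw [e1, dz_conj] at e2
    have e3 : dzbar γ z = - (conj (dzbarAdj ψ α z) * Real.exp (-ψ z)) := by
      rw [← conj_conj (dzbar γ z), e2]
      simp only [map_neg, map_mul, conj_ofReal]
    rw [hz, e3, ← exp_half_mul_self, ← hFG z]
    simp only [RCLike.inner_apply, map_mul, conj_ofReal, ofReal_mul]
    ring
  refine ⟨f, hf, ?_, ?_⟩
  · rintro rfl
    apply hG0
    rw [Lp.eq_zero_iff_ae_eq_zero]
    filter_upwards [hFf] with z hz
    rw [← hFG, hz]
    simp
  · have := hGm.integrable_norm_pow (p := 2) (by norm_num)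
    refine this.congr ?_
    filter_upwards [hFf] with z hz
    rw [← hFG z, norm_mul_exp_half_sq, hz]

end Hormander

section Potential

lemma exists_bound_translates {E : Type} [NormedAddCommGroup E] {L : ℂ → E} (hL : Continuous L)
    (K : Set ℂ) (hK : IsCompact K) (z : ℂ) :
    ∃ B, ∀ x ∈ Metric.closedBall z 1, ∀ w ∈ K, ‖L (x - w)‖ ≤ B := by
  obtain ⟨B, hB⟩ := ((isCompact_closedBall z 1).prod hK).exists_bound_of_continuousOn
    (f := fun p : ℂ × ℂ => L (p.1 - p.2)) (by fun_prop)
  exact ⟨B, fun x hx w hw => hB (x, w) ⟨hx, hw⟩⟩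

/-- Convolution with a compactly supported function, with all derivatives falling on the
other factor. -/
noncomputable def potential {E : Type} [NormedAddCommGroup E] [NormedSpace ℝ E] (h : ℂ → ℝ)
    (L : ℂ → E) (z : ℂ) : E := ∫ w, h w • L (z - w)

variable {E : Type} [NormedAddCommGroup E] [NormedSpace ℝ E] {h : ℂ → ℝ}

lemma integrable_smul_translate (hh : Continuous h) (hc : HasCompactSupport h) {L : ℂ → E}
    (hL : Continuous L) (z : ℂ) : Integrable fun w => h w • L (z - w) :=
  Continuous.integrable_of_hasCompactSupport (by fun_prop) hc.smul_right

lemma continuous_potential (hh : Continuous h) (hc : HasCompactSupport h) {L : ℂ → E}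
    (hL : Continuous L) : Continuous (potential h L) := by
  refine continuous_iff_continuousAt.2 fun z => ?_
  obtain ⟨B, hB⟩ := exists_bound_translates hL (tsupport h) hc z
  refine continuousAt_of_dominated (bound := fun w => ‖h w‖ * B) (.of_forall fun x =>
    (integrable_smul_translate hh hc hL x).aestronglyMeasurable) ?_
    (Continuous.integrable_of_hasCompactSupport (by fun_prop) hc.norm.mul_right)
    (.of_forall fun w => by fun_prop)
  filter_upwards [Metric.closedBall_mem_nhds z one_pos] with x hx
  refine .of_forall fun w => ?_
  rw [norm_smul]
  by_cases hw : w ∈ tsupport h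
  · exact mul_le_mul_of_nonneg_left (hB x hx w hw) (norm_nonneg _)
  · simp [image_eq_zero_of_notMem_tsupport hw]

lemma hasFDerivAt_potential (hh : Continuous h) (hc : HasCompactSupport h) {L : ℂ → E}
    (hL : ContDiff ℝ 1 L) (z : ℂ) :
    HasFDerivAt (potential h L) (potential h (fderiv ℝ L) z) z := by
  have hL' : Continuous (fderiv ℝ L) := hL.continuous_fderiv (by norm_num)
  obtain ⟨B, hB⟩ := exists_bound_translates hL' (tsupport h) hc z
  refine hasFDerivAt_integral_of_dominated_of_fderiv_le (bound := fun w => ‖h w‖ * B)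
    (F' := fun x w => h w • fderiv ℝ L (x - w))
    (Metric.closedBall_mem_nhds z one_pos) (.of_forall fun x =>
    (integrable_smul_translate hh hc hL.continuous x).aestronglyMeasurable)
    (integrable_smul_translate hh hc hL.continuous z)
    (integrable_smul_translate hh hc hL' z).aestronglyMeasurable ?_
    (Continuous.integrable_of_hasCompactSupport (by fun_prop) hc.norm.mul_right) ?_
  · refine .of_forall fun w x hx => ?_
    rw [norm_smul]
    by_cases hw : w ∈ tsupport h
    · exact mul_le_mul_of_nonneg_left (hB x hx w hw) (norm_nonneg _)
    · simp [image_eq_zero_of_notMem_tsupport hw]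
  · refine .of_forall fun w x _ => HasFDerivAt.const_smul ?_ (h w)
    have h1 := (hL.differentiable (by norm_num) (x - w)).hasFDerivAt
    exact h1.comp x ((hasFDerivAt_id x).sub_const w)

lemma contDiff_potential (hh : Continuous h) (hc : HasCompactSupport h) {L : ℂ → E}
    (hL : ContDiff ℝ 2 L) : ContDiff ℝ 2 (potential h L) := by
  have key : ∀ {E : Type} [NormedAddCommGroup E] [NormedSpace ℝ E] {L : ℂ → E},
      ContDiff ℝ 1 L → ContDiff ℝ 1 (potential h L) := by
    intro E _ _ L hL
    rw [contDiff_one_iff_fderiv]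
    refine ⟨fun z => (hasFDerivAt_potential hh hc hL z).differentiableAt, ?_⟩
    rw [funext fun z => (hasFDerivAt_potential hh hc hL z).fderiv]
    exact continuous_potential hh hc (hL.continuous_fderiv (by norm_num))
  have hL1 : ContDiff ℝ 1 L := hL.of_le (by norm_num)
  rw [show (2 : WithTop ℕ∞) = 1 + 1 by norm_num, contDiff_succ_iff_fderiv]
  refine ⟨fun z => (hasFDerivAt_potential hh hc hL1 z).differentiableAt, by simp, ?_⟩
  rw [funext fun z => (hasFDerivAt_potential hh hc hL1 z).fderiv]
  exact key (hL.fderiv_right (by norm_num))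

lemma fderiv_potential_apply (hh : Continuous h) (hc : HasCompactSupport h) {L : ℂ → ℝ}
    (hL : ContDiff ℝ 1 L) (z v : ℂ) :
    fderiv ℝ (potential h L) z v = potential h (fun u => fderiv ℝ L u v) z := by
  rw [(hasFDerivAt_potential hh hc hL z).fderiv, potential, ContinuousLinearMap.integral_apply
    (integrable_smul_translate hh hc (hL.continuous_fderiv (by norm_num)) z)]
  rfl

lemma lap_potential (hh : Continuous h) (hc : HasCompactSupport h) {L : ℂ → ℝ}
    (hL : ContDiff ℝ 2 L) (z : ℂ) : lap (potential h L) z = ∫ w, h w * lap L (z - w) := by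
  have hL1 : ContDiff ℝ 1 L := hL.of_le (by norm_num)
  have hd : ∀ v : ℂ, ContDiff ℝ 1 fun u => fderiv ℝ L u v := fun v =>
    (hL.fderiv_right (m := 1) (by norm_num)).clm_apply contDiff_const
  have hd' : ∀ v : ℂ, Continuous fun u => fderiv ℝ (fun u => fderiv ℝ L u v) u v := fun v =>
    ((hd v).continuous_fderiv (by norm_num)).clm_apply continuous_const
  simp only [lap, pdxR, pdyR, fderiv_potential_apply hh hc hL1]
  erw [fderiv_potential_apply hh hc (hd 1), fderiv_potential_apply hh hc (hd I)]
  simp only [potential, mul_add]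
  exact (integral_add (integrable_smul_translate hh hc (hd' 1) z)
    (integrable_smul_translate hh hc (hd' I) z)).symm

lemma lap_add {f g : ℂ → ℝ} (hf : ContDiff ℝ 2 f) (hg : ContDiff ℝ 2 g) (z : ℂ) :
    lap (fun w => f w + g w) z = lap f z + lap g z := by
  have hd : ∀ {f : ℂ → ℝ}, ContDiff ℝ 2 f → ∀ v : ℂ, Differentiable ℝ fun u => fderiv ℝ f u v :=
    fun hf v => ((hf.fderiv_right (m := 1) (by norm_num)).clm_apply contDiff_const).differentiable
      (by norm_num)
  have h1 : ∀ u, DifferentiableAt ℝ f u := hf.differentiable (by norm_num)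
  have h2 : ∀ u, DifferentiableAt ℝ g u := hg.differentiable (by norm_num)
  simp only [lap, pdxR, pdyR, fderiv_fun_add (h1 _) (h2 _), _root_.add_apply]
  rw [fderiv_fun_add (hd hf 1 z) (hd hg 1 z), fderiv_fun_add (hd hf I z) (hd hg I z)]
  simp only [_root_.add_apply]
  ring

lemma lap_const_mul {f : ℂ → ℝ} (hf : ContDiff ℝ 2 f) (c : ℝ) (z : ℂ) :
    lap (fun w => c * f w) z = c * lap f z := by
  have hd : ∀ v : ℂ, Differentiable ℝ fun u => fderiv ℝ f u v :=
    fun v => ((hf.fderiv_right (m := 1) (by norm_num)).clm_apply contDiff_const).differentiable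
      (by norm_num)
  have h1 : ∀ u, DifferentiableAt ℝ f u := hf.differentiable (by norm_num)
  simp only [lap, pdxR, pdyR, fderiv_const_mul (h1 _), _root_.smul_apply, smul_eq_mul]
  rw [fderiv_const_mul (hd 1 z), fderiv_const_mul (hd I z)]
  simp only [_root_.smul_apply, smul_eq_mul]
  ring

/-- A regularisation of the logarithm `log |z|²`. -/
noncomputable def logReg (η : ℝ) (z : ℂ) : ℝ := Real.log (‖z‖ ^ 2 + η ^ 2)

lemma contDiff_logReg {η : ℝ} (hη : 0 < η) : ContDiff ℝ 2 (logReg η) := by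
  unfold logReg
  exact ((contDiff_norm_sq ℝ).add contDiff_const).log fun z => by positivity

lemma fderiv_logReg {η : ℝ} (hη : 0 < η) (z v : ℂ) :
    fderiv ℝ (logReg η) z v = 2 * (z.re * v.re + z.im * v.im) / (‖z‖ ^ 2 + η ^ 2) := by
  have h : HasFDerivAt (fun z : ℂ => ‖z‖ ^ 2 + η ^ 2) (2 • innerSL ℝ z) z :=
    (hasStrictFDerivAt_norm_sq z).hasFDerivAt.add_const _
  have h2 := (h.log (by positivity)).fderiv
  change fderiv ℝ (logReg η) z = _ at h2
  rw [h2]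
  simp [Complex.inner]
  ring

lemma lap_logReg {η : ℝ} (hη : 0 < η) (z : ℂ) :
    lap (logReg η) z = 4 * η ^ 2 / (‖z‖ ^ 2 + η ^ 2) ^ 2 := by
  have h : HasFDerivAt (fun z : ℂ => ‖z‖ ^ 2 + η ^ 2) (2 • innerSL ℝ z) z :=
    (hasStrictFDerivAt_norm_sq z).hasFDerivAt.add_const _
  have hp : ‖z‖ ^ 2 + η ^ 2 ≠ 0 := by positivity
  have hi : HasFDerivAt (fun z : ℂ => (‖z‖ ^ 2 + η ^ 2)⁻¹)
    (-((‖z‖ ^ 2 + η ^ 2) ^ 2)⁻¹ • (2 • innerSL ℝ z)) z :=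
    (hasDerivAt_inv hp).comp_hasFDerivAt z h
  have hr : HasFDerivAt (fun z : ℂ => 2 * z.re) ((2 : ℝ) • reCLM) z :=
    reCLM.hasFDerivAt.const_mul 2
  have hm : HasFDerivAt (fun z : ℂ => 2 * z.im) ((2 : ℝ) • imCLM) z :=
    imCLM.hasFDerivAt.const_mul 2
  simp only [lap, pdxR, pdyR, fderiv_logReg hη]
  simp only [one_re, one_im, I_re, I_im, mul_zero, mul_one, add_zero, zero_add, div_eq_mul_inv]
  rw [(hr.fun_mul hi).fderiv, (hm.fun_mul hi).fderiv]
  have e : ‖z‖ ^ 2 = z.re * z.re + z.im * z.im := by rw [← normSq_eq_norm_sq, normSq_apply]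
  simp [Complex.inner]
  rw [e] at hp ⊢
  field_simp
  ring

end Potential

section PotentialEstimates

lemma integrable_lap_logReg {η : ℝ} (hη : 0 < η) : Integrable (lap (logReg η)) := by
  have h : Integrable fun z : ℂ => (1 + ‖z‖ ^ 2 : ℝ) ^ (-4 / 2 : ℝ) :=
    integrable_rpow_neg_one_add_norm_sq (by simp [finrank_real_complex]; norm_num)
  refine (h.const_mul (4 * η ^ 2 / min 1 (η ^ 2) ^ 2)).mono'
    (continuous_lap (contDiff_logReg hη)).aestronglyMeasurable (.of_forall fun z => ?_)
  have hm : 0 < min 1 (η ^ 2) := lt_min one_pos (by positivity)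
  have e : (1 + ‖z‖ ^ 2 : ℝ) ^ (-4 / 2 : ℝ) = ((1 + ‖z‖ ^ 2) ^ 2)⁻¹ := by
    rw [show (-4 / 2 : ℝ) = -((2 : ℕ) : ℝ) by norm_num, Real.rpow_neg (by positivity),
      Real.rpow_natCast]
  rw [lap_logReg hη, Real.norm_of_nonneg (by positivity), e, ← div_eq_mul_inv, div_div,
    ← mul_pow]
  have : min 1 (η ^ 2) * (1 + ‖z‖ ^ 2) ≤ ‖z‖ ^ 2 + η ^ 2 := by
    nlinarith [min_le_left 1 (η ^ 2), min_le_right 1 (η ^ 2), sq_nonneg ‖z‖]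
  gcongr

lemma integral_lap_logReg {η : ℝ} (hη : 0 < η) :
    ∫ z, lap (logReg η) z = ∫ z, lap (logReg 1) z := by
  have h := Measure.integral_comp_inv_smul (volume : Measure ℂ) (lap (logReg 1)) η
  rw [finrank_real_complex, abs_of_pos (by positivity), smul_eq_mul] at h
  have e : ∀ z, lap (logReg 1) (η⁻¹ • z) = η ^ 2 * lap (logReg η) z := fun z => by
    rw [lap_logReg one_pos, lap_logReg hη, norm_smul, norm_inv, Real.norm_of_nonneg hη.le]
    field_simp
  simp_rw [e, integral_const_mul] at h
  exact mul_left_cancel₀ (by positivity) h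

lemma integral_lap_logReg_pos : 0 < ∫ z, lap (logReg 1) z := by
  have hp : ∀ z, 0 < lap (logReg 1) z := fun z => by
    rw [lap_logReg one_pos]; positivity
  rw [integral_pos_iff_support_of_nonneg (fun z => (hp z).le) (integrable_lap_logReg one_pos)]
  have : Function.support (lap (logReg 1)) = Set.univ := by
    ext z; simpa using (hp z).ne'
  simp [this]

/-- A compactly supported density is the Laplacian of a function of logarithmic growth, up to an
error of finite mass. -/
lemma exists_potential {h : ℂ → ℝ} (hh : Continuous h) (hc : HasCompactSupport h)
    (h0 : ∀ z, 0 ≤ h z) :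
    ∃ p : ℂ → ℝ, ContDiff ℝ 2 p ∧ (∀ z, lap p z ≤ h z + lap (logReg 1) z) ∧
      ∃ K, ∀ z, (∫ w, h w) / (∫ w, lap (logReg 1) w) * logReg 1 z - K ≤ p z := by
  set κ := ∫ w, lap (logReg 1) w with hκ
  have hκ0 : 0 < κ := integral_lap_logReg_pos
  set m := ∫ w, h w with hm
  have hm0 : 0 ≤ m := integral_nonneg h0
  have hInt : Integrable h := hh.integrable_of_hasCompactSupport hc
  obtain ⟨R, hR0, hR⟩ : ∃ R : ℝ, 0 < R ∧ ∀ w, R < ‖w‖ → h w = 0 := by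
    obtain ⟨R, hR⟩ := hc.isBounded.exists_norm_le
    refine ⟨max R 1, by positivity, fun w hw => image_eq_zero_of_notMem_tsupport fun hw' => ?_⟩
    exact absurd (hR w hw') (by have := le_max_left R 1; linarith)
  obtain ⟨δ, hδ0, hδ⟩ := Metric.uniformContinuous_iff.1
    (hc.uniformContinuous_of_continuous hh) (2 / (1 + (R + 1) ^ 2) ^ 2) (by positivity)
  set d := min δ 1 with hd
  have hd0 : 0 < d := lt_min hδ0 one_pos
  have near : ∀ z w, ‖z - w‖ < d → h w ≤ h z + 2 / (1 + ‖z‖ ^ 2) ^ 2 := by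
    intro z w hzw
    by_cases hz : ‖z‖ ≤ R + 1
    · have h1 := hδ (a := w) (b := z) (by
        rw [dist_comm, dist_eq_norm]; exact hzw.trans_le (min_le_left _ _))
      rw [Real.dist_eq] at h1
      have h2 := (abs_lt.1 h1).2
      have h3 : 2 / (1 + (R + 1) ^ 2) ^ 2 ≤ 2 / (1 + ‖z‖ ^ 2) ^ 2 := by gcongr
      linarith
    · rw [hR w]
      · have := h0 z
        positivity
      · have := norm_sub_norm_le z w
        have := min_le_right δ 1
        linarith
  have hsq : ∀ z w : ℂ, ‖w‖ ≤ R → 1 + ‖z‖ ^ 2 ≤ 2 * ‖z - w‖ ^ 2 + (1 + 2 * R ^ 2) := by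
    intro z w hw
    have h1 : ‖z‖ ≤ ‖z - w‖ + ‖w‖ := by simpa using norm_add_le (z - w) w
    have h2 : ‖z‖ ^ 2 ≤ (‖z - w‖ + ‖w‖) ^ 2 := by gcongr
    have h3 : ‖w‖ ^ 2 ≤ R ^ 2 := by gcongr
    nlinarith [sq_nonneg (‖z - w‖ - ‖w‖)]
  set A := 2 + (1 + 2 * R ^ 2) / d ^ 2 with hA
  have hA0 : 0 < A := by positivity
  have far : ∀ z w : ℂ, ‖w‖ ≤ R → d ≤ ‖z - w‖ → 1 + ‖z‖ ^ 2 ≤ A * ‖z - w‖ ^ 2 := by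
    intro z w hw hzw
    refine (hsq z w hw).trans ?_
    have h1 : d ^ 2 ≤ ‖z - w‖ ^ 2 := by gcongr
    have h2 : 1 + 2 * R ^ 2 ≤ (1 + 2 * R ^ 2) / d ^ 2 * ‖z - w‖ ^ 2 := by
      rw [div_mul_eq_mul_div, le_div_iff₀ (by positivity)]
      gcongr
    rw [hA]; linarith
  obtain ⟨η, hη0, hη⟩ : ∃ η : ℝ, 0 < η ∧ m * (4 * η ^ 2 * A ^ 2) ≤ 2 * κ := by
    refine ⟨√(κ / (2 * A ^ 2 * (m + 1))), by positivity, ?_⟩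
    rw [Real.sq_sqrt (by positivity)]
    have : m * (4 * (κ / (2 * A ^ 2 * (m + 1))) * A ^ 2) = 2 * κ * (m / (m + 1)) := by
      field_simp; norm_num
    rw [this]
    have h1 : m / (m + 1) ≤ 1 := by rw [div_le_one (by positivity)]; linarith
    nlinarith
  have hLη := contDiff_logReg hη0
  have hp2 := contDiff_potential hh hc hLη
  refine ⟨fun z => κ⁻¹ * potential h (logReg η) z, contDiff_const.mul hp2, fun z => ?_, ?_⟩
  · rw [lap_const_mul hp2, lap_potential hh hc hLη, inv_mul_le_iff₀ hκ0, lap_logReg one_pos]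
    have hKi : Integrable fun w => lap (logReg η) (z - w) :=
      (integrable_lap_logReg hη0).comp_sub_left z
    have hb : ∀ w, h w * lap (logReg η) (z - w) ≤
        (h z + 2 / (1 + ‖z‖ ^ 2) ^ 2) * lap (logReg η) (z - w) +
          h w * (4 * η ^ 2 * A ^ 2 / (1 + ‖z‖ ^ 2) ^ 2) := by
      intro w
      have hk0 : 0 ≤ lap (logReg η) (z - w) := by rw [lap_logReg hη0]; positivity
      have hz0 := h0 z
      have hw0 := h0 w
      by_cases hwR : ‖w‖ ≤ R
      · by_cases hzw : ‖z - w‖ < d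
        · have := mul_le_mul_of_nonneg_right (near z w hzw) hk0
          have : 0 ≤ h w * (4 * η ^ 2 * A ^ 2 / (1 + ‖z‖ ^ 2) ^ 2) := by positivity
          linarith
        · have h1 := far z w hwR (not_lt.1 hzw)
          have h2 : lap (logReg η) (z - w) ≤ 4 * η ^ 2 * A ^ 2 / (1 + ‖z‖ ^ 2) ^ 2 := by
            have h3 : 4 * η ^ 2 / (‖z - w‖ ^ 2 + η ^ 2) ^ 2 =
                4 * η ^ 2 * A ^ 2 / (A * (‖z - w‖ ^ 2 + η ^ 2)) ^ 2 := by
              field_simp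
            rw [lap_logReg hη0, h3]
            gcongr
            nlinarith [sq_nonneg η]
          have := mul_le_mul_of_nonneg_left h2 hw0
          have : 0 ≤ (h z + 2 / (1 + ‖z‖ ^ 2) ^ 2) * lap (logReg η) (z - w) := by positivity
          linarith
      · rw [hR w (not_le.1 hwR)]
        simp only [zero_mul, add_zero]
        positivity
    have hI := integral_mono
      (integrable_smul_translate hh hc (continuous_lap hLη) z)
      ((hKi.const_mul (h z + 2 / (1 + ‖z‖ ^ 2) ^ 2)).add
        (hInt.mul_const (4 * η ^ 2 * A ^ 2 / (1 + ‖z‖ ^ 2) ^ 2))) hb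
    refine hI.trans ?_
    simp only [Pi.add_apply]
    rw [integral_add (hKi.const_mul _) (hInt.mul_const _), integral_const_mul, integral_mul_const,
      integral_sub_left_eq_self (lap (logReg η)) volume z, integral_lap_logReg hη0, ← hκ, ← hm]
    have h5 : m * (4 * η ^ 2 * A ^ 2 / (1 + ‖z‖ ^ 2) ^ 2) ≤ 2 * κ / (1 + ‖z‖ ^ 2) ^ 2 := by
      rw [← mul_div_assoc]
      gcongr
    refine (add_le_add_right h5 _).trans (le_of_eq ?_)
    rw [one_pow, mul_one, add_comm (‖z‖ ^ 2) 1]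
    ring
  · set B := 2 + (1 + 2 * R ^ 2) / η ^ 2 with hB
    have hB0 : 0 < B := by positivity
    refine ⟨m / κ * Real.log B, fun z => ?_⟩
    have hlow : ∀ w, h w * (logReg 1 z - Real.log B) ≤ h w * logReg η (z - w) := by
      intro w
      by_cases hwR : ‖w‖ ≤ R
      · refine mul_le_mul_of_nonneg_left ?_ (h0 w)
        rw [sub_le_iff_le_add, logReg, logReg, ← Real.log_mul (by positivity) hB0.ne']
        refine Real.log_le_log (by positivity) ?_
        have h1 := hsq z w hwR
        have h2 : (1 + 2 * R ^ 2) ≤ (1 + 2 * R ^ 2) / η ^ 2 * (‖z - w‖ ^ 2 + η ^ 2) := by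
          rw [div_mul_eq_mul_div, le_div_iff₀ (by positivity)]
          gcongr
          nlinarith [sq_nonneg ‖z - w‖]
        rw [hB]
        nlinarith [sq_nonneg η]
      · simp [hR w (not_le.1 hwR)]
    have hI := integral_mono (hInt.mul_const _)
      (integrable_smul_translate hh hc hLη.continuous z) hlow
    rw [integral_mul_const, ← hm] at hI
    have h6 := mul_le_mul_of_nonneg_left hI (inv_nonneg.2 hκ0.le)
    refine le_trans (le_of_eq ?_) h6
    ring

end PotentialEstimates

section Weight

lemma exp_neg_two_logReg {ε : ℝ} (hε : 0 < ε) (z : ℂ) :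
    Real.exp (-(2 * logReg ε z)) = ((‖z‖ ^ 2 + ε ^ 2) ^ 2)⁻¹ := by
  have hp : 0 < ‖z‖ ^ 2 + ε ^ 2 := by positivity
  rw [Real.exp_neg, logReg, ← Real.log_rpow hp, Real.exp_log (by positivity)]
  norm_cast

/-- A strictly subharmonic weight, perturbed by a regularised logarithmic pole, carries a nonzero
square integrable entire function. -/
lemma exists_entire_of_lap_pos {θ : ℂ → ℝ} (hθ : ContDiff ℝ 2 θ) (hlap : ∀ z, 0 < lap θ z) :
    ∃ ε : ℝ, 0 < ε ∧ ε ≤ 1 ∧ ∃ f : ℂ → ℂ, Differentiable ℂ f ∧ f ≠ 0 ∧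
      Integrable fun z => ‖f z‖ ^ 2 * Real.exp (-(θ z + 2 * logReg ε z)) := by
  let b : ContDiffBump (0 : ℂ) := ⟨1, 2, one_pos, one_lt_two⟩
  set χ : ℂ → ℂ := fun z => (b z : ℂ) with hχdef
  have hχ : ContDiff ℝ 2 χ := ofRealCLM.contDiff.comp b.contDiff
  have hχc : HasCompactSupport χ := b.hasCompactSupport.comp_left (g := ofReal) (by simp)
  have hχ1 : ∀ z, ‖z‖ ≤ 1 → χ z = 1 := fun z hz => by
    simp [hχdef, b.one_of_mem_closedBall (x := z) (by simpa [b] using hz)]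
  have hdχ : ∀ z, ‖z‖ < 1 → dz χ z = 0 := fun z hz => by
    have h1 : χ =ᶠ[nhds z] fun _ => 1 := by
      filter_upwards [Metric.isOpen_ball.mem_nhds
        (show z ∈ Metric.ball (0 : ℂ) 1 by simpa using hz)] with w hw
      exact hχ1 w (by simpa using (mem_ball_zero_iff.1 hw).le)
    simp [dz, h1.fderiv_eq]
  have hdχc : Continuous (dz χ) := continuous_dz (hχ.of_le (by norm_num))
  have hθc := hθ.continuous
  obtain ⟨m, hm0, hm⟩ : ∃ m : ℝ, 0 < m ∧ ∀ z : ℂ, ‖z‖ ≤ 1 → m ≤ Real.exp (-θ z) := by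
    obtain ⟨B, hB⟩ := (isCompact_closedBall (0 : ℂ) 1).exists_bound_of_continuousOn
      hθc.continuousOn
    refine ⟨Real.exp (-B), Real.exp_pos _, fun z hz => Real.exp_le_exp.2 ?_⟩
    have := (abs_le.1 (hB z (by simpa using hz))).2
    linarith
  have hcont : ∀ {ψ : ℂ → ℝ}, ContDiff ℝ 2 ψ → (∀ z, 0 < lap ψ z) →
      Integrable fun z => ‖dz χ z‖ ^ 2 / (lap ψ z / 4) * Real.exp (-ψ z) := by
    intro ψ hψ hψl
    have h1 := continuous_lap hψ
    have h2 := hψ.continuous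
    refine Continuous.integrable_of_hasCompactSupport (Continuous.mul (Continuous.div (by fun_prop)
      (by fun_prop) fun z => by have := hψl z; positivity) (by fun_prop)) ?_
    refine hχc.dz.mono fun z hz => ?_
    contrapose! hz
    simp only [Function.mem_support, not_not] at hz ⊢
    simp [hz]
  set B := ∫ z, ‖dz χ z‖ ^ 2 / (lap θ z / 4) * Real.exp (-θ z) with hB
  have hB0 : 0 ≤ B := integral_nonneg fun z => by have := hlap z; positivity
  obtain ⟨ε, hε0, hε1, hε⟩ : ∃ ε : ℝ, 0 < ε ∧ ε ≤ 1 ∧ B < m * Real.pi / (4 * ε ^ 2) := by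
    refine ⟨min 1 √(m * Real.pi / (4 * (B + 1))), by positivity, min_le_left _ _, ?_⟩
    rw [lt_div_iff₀ (by positivity)]
    have h1 : (min 1 √(m * Real.pi / (4 * (B + 1)))) ^ 2 ≤ m * Real.pi / (4 * (B + 1)) := by
      calc _ ≤ √(m * Real.pi / (4 * (B + 1))) ^ 2 := by gcongr; exact min_le_right _ _
        _ = _ := Real.sq_sqrt (by positivity)
    calc B * (4 * (min 1 √(m * Real.pi / (4 * (B + 1)))) ^ 2)
        ≤ B * (4 * (m * Real.pi / (4 * (B + 1)))) := by gcongr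
      _ = m * Real.pi * (B / (B + 1)) := by field_simp
      _ < m * Real.pi * 1 := by
        have h2 : B / (B + 1) < 1 := by rw [div_lt_one (by positivity)]; linarith
        have h3 : 0 < m * Real.pi := by positivity
        exact mul_lt_mul_of_pos_left h2 h3
      _ = m * Real.pi := mul_one _
  have hL := contDiff_logReg hε0
  have hL2 : ContDiff ℝ 2 fun z => 2 * logReg ε z := contDiff_const.mul hL
  have hΨ : ContDiff ℝ 2 fun z => θ z + 2 * logReg ε z := hθ.add hL2
  have hΨl : ∀ z, lap θ z ≤ lap (fun z => θ z + 2 * logReg ε z) z := fun z => by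
    rw [lap_add hθ hL2, lap_const_mul hL, lap_logReg hε0]
    have : 0 ≤ 2 * (4 * ε ^ 2 / (‖z‖ ^ 2 + ε ^ 2) ^ 2) := by positivity
    linarith
  have hΨp : ∀ z, 0 < lap (fun z => θ z + 2 * logReg ε z) z := fun z => (hlap z).trans_le (hΨl z)
  have hexp : ∀ z, Real.exp (-(θ z + 2 * logReg ε z)) =
      Real.exp (-θ z) * ((‖z‖ ^ 2 + ε ^ 2) ^ 2)⁻¹ := fun z => by
    rw [neg_add, Real.exp_add, exp_neg_two_logReg hε0]
  refine ⟨ε, hε0, hε1, exists_entire_of_cutoff hΨ hΨp hχ hχc ?_⟩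
  calc ∫ z, ‖dz χ z‖ ^ 2 / (lap (fun z => θ z + 2 * logReg ε z) z / 4) *
        Real.exp (-(θ z + 2 * logReg ε z))
      ≤ B := by
        refine integral_mono (hcont hΨ hΨp) (hcont hθ hlap) fun z => ?_
        by_cases hz : ‖z‖ < 1
        · simp [hdχ z hz]
        · have h1 := hlap z
          have h2 := hΨl z
          have h3 : Real.exp (-(θ z + 2 * logReg ε z)) ≤ Real.exp (-θ z) := by
            rw [hexp]
            refine mul_le_of_le_one_right (Real.exp_pos _).le (inv_le_one_of_one_le₀ ?_)
            have : 1 ≤ ‖z‖ := not_lt.1 hz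
            exact one_le_pow₀ (by nlinarith [sq_nonneg ε])
          show _ / _ * _ ≤ _ / _ * _
          gcongr
    _ < m * Real.pi / (4 * ε ^ 2) := hε
    _ = ∫ z, (Metric.ball (0 : ℂ) ε).indicator (fun _ => m * ((2 * ε ^ 2) ^ 2)⁻¹) z := by
        rw [integral_indicator Metric.isOpen_ball.measurableSet, setIntegral_const, measureReal_def,
          Complex.volume_ball]
        simp [hε0.le]
        field_simp
        norm_num
    _ ≤ ∫ z, ‖χ z‖ ^ 2 * Real.exp (-(θ z + 2 * logReg ε z)) := by
        have h2 := hΨ.continuous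
        have h3 := hχ.continuous
        refine integral_mono ?_ ?_ fun z => ?_
        · refine (integrable_indicator_iff Metric.isOpen_ball.measurableSet).2
            (integrableOn_const ?_)
          exact Metric.isBounded_ball.measure_lt_top.ne
        · refine Continuous.integrable_of_hasCompactSupport (by fun_prop) (hχc.mono fun z hz => ?_)
          contrapose! hz
          simp only [Function.mem_support, not_not] at hz ⊢
          simp [hz]
        · refine Set.indicator_le' (f := fun _ => m * ((2 * ε ^ 2) ^ 2)⁻¹)
            (g := fun w => ‖χ w‖ ^ 2 * Real.exp (-(θ w + 2 * logReg ε w)))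
            (fun w hw => ?_) (fun w _ => by positivity) z
          have hw' : ‖w‖ ≤ ε := (mem_ball_zero_iff.1 hw).le
          rw [hχ1 w (hw'.trans hε1), hexp, norm_one, one_pow, one_mul]
          have h5 := hm w (hw'.trans hε1)
          have h4 : ‖w‖ ^ 2 + ε ^ 2 ≤ 2 * ε ^ 2 := by
            have : ‖w‖ ^ 2 ≤ ε ^ 2 := by gcongr
            linarith
          gcongr

lemma logReg_mono {ε η : ℝ} (hε : 0 < ε) (h : ε ≤ η) (z : ℂ) : logReg ε z ≤ logReg η z :=
  Real.log_le_log (by positivity) (by gcongr)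

/-- If the Laplacian of `φ` has infinite mass, there are nonzero entire functions all of whose
multiples by polynomials of bounded degree are square integrable. -/
lemma exists_entire_pow_mul_integrable {φ : ℂ → ℝ} (hφ : ContDiff ℝ 2 φ)
    (hmass : ∀ N : ℝ, ∃ h : ℂ → ℝ, Continuous h ∧ HasCompactSupport h ∧ (∀ z, 0 ≤ h z) ∧
      (∀ z, h z ≤ lap φ z) ∧ N ≤ ∫ z, h z) (k : ℕ) :
    ∃ f : ℂ → ℂ, Differentiable ℂ f ∧ f ≠ 0 ∧
      ∀ j ≤ k, Integrable fun z => ‖z ^ j * f z‖ ^ 2 * Real.exp (-φ z) := by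
  have hκ := integral_lap_logReg_pos
  obtain ⟨h, hh, hc, h0, hle, hN⟩ := hmass ((k + 4) * ∫ w, lap (logReg 1) w)
  obtain ⟨p, hp, hpl, K, hK⟩ := exists_potential hh hc h0
  have hL := contDiff_logReg one_pos
  have hp' : ContDiff ℝ 2 fun z => (-1) * p z := contDiff_const.mul hp
  have hL' : ContDiff ℝ 2 fun z => 2 * logReg 1 z := contDiff_const.mul hL
  have hpL : ContDiff ℝ 2 fun z => (-1) * p z + 2 * logReg 1 z := hp'.add hL'
  obtain ⟨ε, hε0, hε1, f, hf, hf0, hfi⟩ := exists_entire_of_lap_pos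
    (θ := fun z => φ z + ((-1) * p z + 2 * logReg 1 z)) (hφ.add hpL) fun z => by
      rw [lap_add hφ hpL, lap_add hp' hL', lap_const_mul hp, lap_const_mul hL]
      have h1 : 0 < lap (logReg 1) z := by rw [lap_logReg one_pos]; positivity
      linarith [hpl z, hle z]
  refine ⟨f, hf, hf0, fun j hj => ?_⟩
  have hφc := hφ.continuous
  have hfc := hf.continuous
  refine (hfi.const_mul (Real.exp K)).mono' (by fun_prop) (.of_forall fun z => ?_)
  have hl0 : 0 ≤ logReg 1 z := Real.log_nonneg (by nlinarith [sq_nonneg ‖z‖])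
  have hpz : (k + 4) * logReg 1 z - K ≤ p z := by
    refine le_trans ?_ (hK z)
    gcongr
    rwa [le_div_iff₀ hκ]
  have hpow : ‖z ^ j‖ ^ 2 ≤ Real.exp (k * logReg 1 z) := by
    have h1 : (1 : ℝ) ≤ ‖z‖ ^ 2 + 1 ^ 2 := by nlinarith [sq_nonneg ‖z‖]
    rw [logReg, mul_comm, Real.exp_mul, Real.exp_log (by positivity), Real.rpow_natCast, norm_pow,
      ← pow_mul, mul_comm j 2, pow_mul]
    calc (‖z‖ ^ 2) ^ j ≤ (‖z‖ ^ 2 + 1 ^ 2) ^ j := by gcongr; linarith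
      _ ≤ _ := pow_le_pow_right₀ h1 hj
  rw [Real.norm_of_nonneg (by positivity), norm_mul, mul_pow]
  calc ‖z ^ j‖ ^ 2 * ‖f z‖ ^ 2 * Real.exp (-φ z)
      ≤ Real.exp (k * logReg 1 z) * ‖f z‖ ^ 2 * Real.exp (-φ z) := by gcongr
    _ = ‖f z‖ ^ 2 * Real.exp (k * logReg 1 z + -φ z) := by rw [Real.exp_add]; ring
    _ ≤ ‖f z‖ ^ 2 * Real.exp (K + -(φ z + ((-1) * p z + 2 * logReg 1 z) + 2 * logReg ε z)) := by
      refine mul_le_mul_of_nonneg_left (Real.exp_le_exp.2 ?_) (by positivity)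
      linarith [logReg_mono hε0 hε1 z]
    _ = _ := by rw [Real.exp_add]; ring

end Weight

section Doubling

open scoped ENNReal

lemma measure_univ_eq_top_of_doubling {μ : Measure ℂ} (hμ : μ ≠ 0) {C : ℝ}
    (hdoubling : ∀ (z : ℂ) (r : ℝ), 0 < r →
      μ (Metric.ball z r) ≤ ENNReal.ofReal C * μ (Metric.ball z (r / 2))) :
    μ Set.univ = ∞ := by
  by_contra hfin
  set c := ENNReal.ofReal C with hc
  have step : ∀ R : ℝ, 0 < R → (c * c + 1) * μ (Metric.ball 0 R) ≤ c * c * μ Set.univ := by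
    intro R hR
    set w : ℂ := ((2 * R : ℝ) : ℂ) with hw
    have hwn : ‖w‖ = 2 * R := by rw [hw, norm_real, Real.norm_of_nonneg (by positivity)]
    have h1 : μ (Metric.ball 0 R) ≤ c * c * μ (Metric.ball w R) := by
      calc μ (Metric.ball 0 R) ≤ μ (Metric.ball w (4 * R)) :=
            measure_mono (Metric.ball_subset_ball' (by rw [dist_zero_left, hwn]; linarith))
        _ ≤ c * μ (Metric.ball w (4 * R / 2)) := hdoubling w _ (by positivity)
        _ ≤ c * (c * μ (Metric.ball w (4 * R / 2 / 2))) := by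
            gcongr
            exact hdoubling w _ (by positivity)
        _ = _ := by rw [mul_assoc]; ring_nf
    have hdisj : Disjoint (Metric.ball (0 : ℂ) R) (Metric.ball w R) :=
      Metric.ball_disjoint_ball (by rw [dist_zero_left, hwn]; linarith)
    calc (c * c + 1) * μ (Metric.ball 0 R)
        = c * c * μ (Metric.ball 0 R) + μ (Metric.ball 0 R) := by ring
      _ ≤ c * c * μ (Metric.ball 0 R) + c * c * μ (Metric.ball w R) := by gcongr
      _ = c * c * μ (Metric.ball 0 R ∪ Metric.ball w R) := by
          rw [measure_union hdisj Metric.isOpen_ball.measurableSet, mul_add]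
      _ ≤ c * c * μ Set.univ := by gcongr; exact Set.subset_univ _
  have hsup : μ Set.univ = ⨆ n : ℕ, μ (Metric.ball (0 : ℂ) n) := by
    rw [← Metric.iUnion_ball_nat (0 : ℂ)]
    exact Monotone.measure_iUnion fun a b hab => Metric.ball_subset_ball (by exact_mod_cast hab)
  have hall : (c * c + 1) * μ Set.univ ≤ c * c * μ Set.univ := by
    conv_lhs => rw [hsup, ENNReal.mul_iSup]
    refine iSup_le fun n => ?_
    rcases Nat.eq_zero_or_pos n with rfl | hn
    · simp
    · exact step n (by exact_mod_cast hn)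
  have hcc : c * c * μ Set.univ ≠ ∞ := ENNReal.mul_ne_top
    (ENNReal.mul_ne_top ENNReal.ofReal_ne_top ENNReal.ofReal_ne_top) hfin
  rw [add_mul, one_mul] at hall
  have hpos : μ Set.univ ≠ 0 := by simpa using hμ
  exact absurd hall (not_le.2 (ENNReal.lt_add_right hcc hpos))

lemma exists_compactly_supported_minorant {u : ℂ → ℝ} (hu : Continuous u) (hu0 : ∀ z, 0 ≤ u z)
    (htop : (volume.withDensity fun z => ENNReal.ofReal (u z)) Set.univ = ∞) (N : ℝ) :
    ∃ h : ℂ → ℝ, Continuous h ∧ HasCompactSupport h ∧ (∀ z, 0 ≤ h z) ∧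
      (∀ z, h z ≤ u z) ∧ N ≤ ∫ z, h z := by
  rw [← Metric.iUnion_ball_nat (0 : ℂ), Monotone.measure_iUnion fun a b hab =>
    Metric.ball_subset_ball (by exact_mod_cast hab), iSup_eq_top] at htop
  obtain ⟨n, hn⟩ := htop (ENNReal.ofReal N) ENNReal.ofReal_lt_top
  let b : ContDiffBump (0 : ℂ) := ⟨n + 1, n + 2, by positivity, by linarith⟩
  have hhc : Continuous fun z => b z * u z := b.continuous.mul hu
  have hcs : HasCompactSupport fun z => b z * u z := b.hasCompactSupport.mul_right
  have hh0 : ∀ z, 0 ≤ b z * u z := fun z => mul_nonneg b.nonneg (hu0 z)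
  refine ⟨fun z => b z * u z, hhc, hcs, hh0, fun z => mul_le_of_le_one_left (hu0 z) b.le_one, ?_⟩
  rw [← ENNReal.ofReal_le_ofReal_iff (integral_nonneg hh0), ofReal_integral_eq_lintegral_ofReal
    (hhc.integrable_of_hasCompactSupport hcs) (.of_forall hh0)]
  refine hn.le.trans ?_
  rw [withDensity_apply _ Metric.isOpen_ball.measurableSet,
    ← lintegral_indicator Metric.isOpen_ball.measurableSet]
  refine lintegral_mono fun z => Set.indicator_le (g := fun w => ENNReal.ofReal (b w * u w))
    (fun w hw => ?_) z
  have hb : b w = 1 := b.one_of_mem_closedBall (by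
    have := mem_ball_zero_iff.1 hw
    simp only [mem_closedBall_zero_iff, b]
    linarith)
  rw [hb, one_mul]

end Doubling

section Dimension

/-- The weighted Bergman space `A²(ℂ, e^{-φ})`. -/
noncomputable def bergmanSpace (φ : ℂ → ℝ) (hφ : Continuous φ) : Submodule ℂ (ℂ → ℂ) where
  carrier := {f | Differentiable ℂ f ∧ Integrable fun z => ‖f z‖ ^ 2 * Real.exp (-φ z)}
  add_mem' := by
    rintro f g ⟨hf, hfi⟩ ⟨hg, hgi⟩
    refine ⟨hf.add hg, ?_⟩
    have hfc := hf.continuous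
    have hgc := hg.continuous
    refine ((hfi.const_mul 2).add (hgi.const_mul 2)).mono'
      (Continuous.aestronglyMeasurable (by fun_prop)) (.of_forall fun z => ?_)
    rw [Real.norm_of_nonneg (by positivity)]
    have h1 : ‖f z + g z‖ ^ 2 ≤ 2 * ‖f z‖ ^ 2 + 2 * ‖g z‖ ^ 2 := by
      have h2 : ‖f z + g z‖ ^ 2 ≤ (‖f z‖ + ‖g z‖) ^ 2 := by
        gcongr
        exact norm_add_le _ _
      nlinarith [sq_nonneg (‖f z‖ - ‖g z‖)]
    have := mul_le_mul_of_nonneg_right h1 (Real.exp_pos (-φ z)).le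
    simp only [Pi.add_apply]
    linarith
  zero_mem' := ⟨differentiable_const 0, by simp⟩
  smul_mem' := by
    rintro c f ⟨hf, hfi⟩
    refine ⟨hf.const_smul c, ?_⟩
    simpa [norm_smul, mul_pow, mul_assoc] using hfi.const_mul (‖c‖ ^ 2)

lemma linearIndependent_pow_mul {f : ℂ → ℂ} (hf : Continuous f) (hf0 : f ≠ 0) :
    LinearIndependent ℂ fun (j : ℕ) (z : ℂ) => z ^ j * f z := by
  let T : Polynomial ℂ →ₗ[ℂ] (ℂ → ℂ) :=
    { toFun := fun P z => P.eval z * f z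
      map_add' := fun P Q => by ext z; simp [add_mul]
      map_smul' := fun c P => by ext z; simp [mul_assoc] }
  have hT : LinearMap.ker T = ⊥ := by
    rw [LinearMap.ker_eq_bot']
    intro P hP
    obtain ⟨z₀, hz₀⟩ := Function.ne_iff.1 hf0
    have hev : ∀ᶠ z in nhds z₀, f z ≠ 0 := hf.continuousAt.eventually_ne hz₀
    refine Polynomial.eq_zero_of_infinite_isRoot P
      ((infinite_of_mem_nhds z₀ hev).mono fun z hz => ?_)
    have := congrFun hP z
    exact (mul_eq_zero.1 this).resolve_right hz
  have h := (Polynomial.basisMonomials ℂ).linearIndependent.map' T hT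
  have e : T ∘ Polynomial.basisMonomials ℂ = fun (j : ℕ) (z : ℂ) => z ^ j * f z := by
    ext j z
    simp [T]
  rwa [e] at h

lemma not_finite_bergmanSpace {φ : ℂ → ℝ} (hφ : Continuous φ)
    (h : ∀ k : ℕ, ∃ f : ℂ → ℂ, Differentiable ℂ f ∧ f ≠ 0 ∧
      ∀ j ≤ k, Integrable fun z => ‖z ^ j * f z‖ ^ 2 * Real.exp (-φ z)) :
    ¬ Module.Finite ℂ (bergmanSpace φ hφ) := by
  intro hfin
  obtain ⟨f, hf, hf0, hi⟩ := h (Module.finrank ℂ (bergmanSpace φ hφ))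
  have hli := (linearIndependent_pow_mul hf.continuous hf0).comp
    (fun j : Fin (Module.finrank ℂ (bergmanSpace φ hφ) + 1) => (j : ℕ)) Fin.val_injective
  let v : Fin (Module.finrank ℂ (bergmanSpace φ hφ) + 1) → bergmanSpace φ hφ := fun j =>
    ⟨fun z => z ^ (j : ℕ) * f z, (differentiable_id.pow _).mul hf, hi j (Nat.lt_succ_iff.1 j.2)⟩
  have hv : LinearIndependent ℂ v := LinearIndependent.of_comp (bergmanSpace φ hφ).subtype hli
  have := hv.fintype_card_le_finrank
  simp at this

end Dimension

/-- Let `φ : ℂ → ℝ` be a nonnegative subharmonic `C²` function such that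
`dμ = Δφ dλ` is a nontrivial doubling measure. Then the weighted Bergman space
`A²(ℂ, e^{-φ})` of entire functions `f` with `∫ |f|² e^{-φ} dλ < ∞` is an
infinite-dimensional complex vector space. -/
theorem bergman_space_infinite_dimensional
    (φ : ℂ → ℝ) (hφC2 : ContDiff ℝ 2 φ) (hφ0 : ∀ z, 0 ≤ φ z)
    (hsub : ∀ z, 0 ≤ lap φ z)
    (μ : Measure ℂ)
    (hμdef : μ = volume.withDensity fun z => ENNReal.ofReal (lap φ z))
    (hμne : μ ≠ 0)
    (C : ℝ) (hC : 0 < C)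
    (hdoubling : ∀ (z : ℂ) (r : ℝ), 0 < r →
      μ (Metric.ball z r) ≤ ENNReal.ofReal C * μ (Metric.ball z (r / 2))) :
    ∃ g : ℕ → ℂ → ℂ,
      (∀ k, Differentiable ℂ (g k) ∧
        Integrable (fun z => ‖g k z‖ ^ 2 * Real.exp (-(φ z)))) ∧
      LinearIndependent ℂ g := by
  subst hμdef
  have hnf := not_finite_bergmanSpace hφC2.continuous (exists_entire_pow_mul_integrable hφC2
    (exists_compactly_supported_minorant (continuous_lap hφC2) hsub
      (measure_univ_eq_top_of_doubling hμne hdoubling)))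
  have b := Module.Basis.ofVectorSpace ℂ (bergmanSpace φ hφC2.continuous)
  have hinf : Infinite (Module.Basis.ofVectorSpaceIndex ℂ (bergmanSpace φ hφC2.continuous)) := by
    rw [← not_finite_iff_infinite]
    intro hfin
    exact hnf (Module.Finite.of_basis b)
  refine ⟨fun k => (b (Infinite.natEmbedding _ k) : ℂ → ℂ), fun k => (b _).2, ?_⟩
  exact (b.linearIndependent.comp _ (Infinite.natEmbedding _).injective).map'
    (bergmanSpace φ hφC2.continuous).subtype (Submodule.ker_subtype _)
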